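/- arXiv:1704.04163 — 11 statements merged into one kernel-verified Lean document; each statement's English description precedes it below -/
import Mathlib

section
/- Let p ∈ [-1, 0). For each natural number k define a_k = ∏_{j=1}^{k} (1 - (p+1)/j) (with a_0 = 1) and the polynomial q_k(x) = Σ_{j=0}^{k} a_j (1-x)^j. Then for every k ≥ 0 one has 0 ≤ a_k ≤ 1, and for every x ∈ (0,1] and every k ≥ 0 one has 0 ≤ x^p - q_k(x) ≤ exp(-k·x)/x. -/
open Finset

/-- The rising-factorial coefficient `multichoose (-p) k` as a product. -/
lemma multichoose_neg_eq_prod_Icc (p : ℝ) (k : ℕ) :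
    Ring.multichoose (-p) k = ∏ j ∈ Icc 1 k, (1 - (p + 1) / (j : ℝ)) := by
  have key (n : ℕ) : (n.factorial : ℝ) * Ring.multichoose (-p) n =
      (ascPochhammer ℝ n).eval (-p) := by
    rw [← nsmul_eq_mul, Ring.factorial_nsmul_multichoose_eq_ascPochhammer,
      Polynomial.ascPochhammer_smeval_eq_eval]
  induction k with
  | zero => simp
  | succ k ih =>
    have h : ((k + 1).factorial : ℝ) * Ring.multichoose (-p) (k + 1) =
        ((k + 1).factorial : ℝ) *
          (Ring.multichoose (-p) k * (1 - (p + 1) / ((k + 1 : ℕ) : ℝ))) := by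
      rw [key, ascPochhammer_succ_eval, ← key k, Nat.factorial_succ]
      push_cast
      field_simp
      ring
    rw [prod_Icc_succ_top (by omega), ← ih]
    exact mul_left_cancel₀ (by positivity) h

lemma hasSum_prod_mul_one_sub_pow (p : ℝ) {x : ℝ} (hx : x ∈ Set.Ioc (0 : ℝ) 1) :
    HasSum (fun n : ℕ ↦ (∏ j ∈ Icc 1 n, (1 - (p + 1) / (j : ℝ))) * (1 - x) ^ n) (x ^ p) := by
  have hmem : (1 - x) ∈ Metric.eball (0 : ℝ) 1 := by
    rw [Metric.mem_eball, edist_zero_right, Real.enorm_eq_ofReal (by linarith [hx.2]),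
      ENNReal.ofReal_lt_one]
    linarith [hx.1]
  have h := (Real.one_div_one_sub_rpow_hasFPowerSeriesOnBall_zero (-p)).hasSum hmem
  rw [zero_add, sub_sub_cancel, Real.rpow_neg hx.1.le, one_div, inv_inv] at h
  convert! h using 2 with n
  rw [← multichoose_neg_eq_prod_Icc, Ring.multichoose_eq]
  simp [FormalMultilinearSeries.ofScalars]

lemma prod_one_sub_div_mem_Icc {p : ℝ} (hp : p ∈ Set.Icc (-1 : ℝ) 0) (k : ℕ) :
    ∏ j ∈ Icc 1 k, (1 - (p + 1) / (j : ℝ)) ∈ Set.Icc (0 : ℝ) 1 := by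
  have hfac (j : ℕ) (hj : j ∈ Icc 1 k) :
      0 ≤ 1 - (p + 1) / (j : ℝ) ∧ 1 - (p + 1) / (j : ℝ) ≤ 1 := by
    have hj' : (1 : ℝ) ≤ j := by exact_mod_cast (mem_Icc.1 hj).1
    have h₁ : (p + 1) / (j : ℝ) ≤ 1 := div_le_one_of_le₀ (by linarith [hp.2]) (by linarith)
    have h₂ : 0 ≤ (p + 1) / (j : ℝ) := div_nonneg (by linarith [hp.1]) (by linarith)
    constructor <;> linarith
  exact ⟨prod_nonneg fun j hj ↦ (hfac j hj).1,
    prod_le_one (fun j hj ↦ (hfac j hj).1) fun j hj ↦ (hfac j hj).2⟩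


/-- Taylor polynomial approximation of `x ^ p` about `1` for `p ∈ [-1,0)`:
the coefficients `a k = ∏_{j=1}^k (1 - (p+1)/j)` lie in `[0,1]`, and for `x ∈ (0,1]`,
`0 ≤ x^p - q_k(x) ≤ exp(-k x)/x` where `q_k(x) = ∑_{j=0}^k a_j (1-x)^j`. -/
theorem stmt_0 (p : ℝ) (hp : p ∈ Set.Ico (-1 : ℝ) 0)
    (a : ℕ → ℝ) (ha : ∀ k, a k = ∏ j ∈ Finset.Icc 1 k, (1 - (p + 1) / (j : ℝ)))
    (q : ℕ → ℝ → ℝ)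
    (hq : ∀ k x, q k x = ∑ j ∈ Finset.range (k + 1), a j * (1 - x) ^ j) :
    (∀ k : ℕ, 0 ≤ a k ∧ a k ≤ 1) ∧
    ∀ x ∈ Set.Ioc (0 : ℝ) 1, ∀ k : ℕ,
      0 ≤ x ^ p - q k x ∧ x ^ p - q k x ≤ Real.exp (-(k : ℝ) * x) / x := by
  have hab (k : ℕ) : 0 ≤ a k ∧ a k ≤ 1 := by
    rw [ha]
    exact prod_one_sub_div_mem_Icc ⟨hp.1, hp.2.le⟩ k
  refine ⟨hab, fun x hx k ↦ ?_⟩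
  have hy : 0 ≤ 1 - x := by linarith [hx.2]
  have hsum : HasSum (fun n ↦ a n * (1 - x) ^ n) (x ^ p) := by
    simpa only [ha] using hasSum_prod_mul_one_sub_pow p hx
  have htail := (hasSum_nat_add_iff' (k + 1)).2 hsum
  rw [← hq] at htail
  have hgeom := (hasSum_geometric_of_lt_one hy (by linarith [hx.1])).mul_left ((1 - x) ^ (k + 1))
  rw [sub_sub_cancel] at hgeom
  refine ⟨htail.nonneg fun n ↦ mul_nonneg (hab _).1 (pow_nonneg hy _), ?_⟩
  calc x ^ p - q k x ≤ (1 - x) ^ (k + 1) * x⁻¹ := by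
        refine hasSum_le (fun n ↦ ?_) htail hgeom
        rw [← pow_add, add_comm (k + 1) n]
        exact mul_le_of_le_one_left (pow_nonneg hy _) (hab _).2
    _ ≤ Real.exp (-(k : ℝ) * x) * x⁻¹ := by
        refine mul_le_mul_of_nonneg_right ?_ (inv_nonneg.2 hx.1.le)
        calc (1 - x) ^ (k + 1) ≤ (1 - x) ^ k :=
              pow_le_pow_of_le_one hy (by linarith [hx.1]) k.le_succ
          _ ≤ Real.exp (-x) ^ k := pow_le_pow_left₀ hy (Real.one_sub_le_exp_neg x) k
          _ = Real.exp (-(k : ℝ) * x) := by rw [← Real.exp_nat_mul]; ring_nf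
    _ = Real.exp (-(k : ℝ) * x) / x := (div_eq_mul_inv _ _).symm
end

section
/- There is an absolute constant C > 0 with the following property. For every p > 0, every ε ∈ (0,1), and every pair of reals a, b with 0 < a < b ≤ 1, there exists a real polynomial q of degree at most C·((b/a)·log(b/(a·ε)) + p + 1) such that: (i) |q(x) - x^p| ≤ ε·x^p for every x ∈ [a,b]; (ii) q is nonnegative and nondecreasing on [0,b]; and (iii) q(0) = 0. -/
/-- The coefficients of the power series of `(1 - y) ^ (-s)`. -/
noncomputable def negBinomCoeff (s : ℝ) : ℕ → ℝ
  | 0 => 1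
  | j + 1 => negBinomCoeff s j * (s + j) / (j + 1)

lemma negBinomCoeff_nonneg {s : ℝ} (hs : 0 ≤ s) (j : ℕ) : 0 ≤ negBinomCoeff s j := by
  induction j with
  | zero => simp [negBinomCoeff]
  | succ j ih => rw [negBinomCoeff]; positivity

lemma negBinomCoeff_le_one {s : ℝ} (hs : 0 ≤ s) (hs1 : s ≤ 1) (j : ℕ) :
    negBinomCoeff s j ≤ 1 := by
  induction j with
  | zero => simp [negBinomCoeff]
  | succ j ih =>
    rw [negBinomCoeff, div_le_one (by positivity)]
    have := mul_le_mul ih (show s + j ≤ 1 + j by linarith) (by positivity) zero_le_one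
    linarith

lemma succ_mul_negBinomCoeff_succ (s : ℝ) (j : ℕ) :
    ((j : ℝ) + 1) * negBinomCoeff s (j + 1) = (s + j) * negBinomCoeff s j := by
  rw [negBinomCoeff]
  field_simp

/-- The truncation at order `N` of the expansion of `x ^ (-s)` in powers of `1 - x`. -/
noncomputable def negPowTaylor (s : ℝ) (N : ℕ) : Polynomial ℝ :=
  ∑ j ∈ Finset.range (N + 1), Polynomial.C (negBinomCoeff s j) * (1 - Polynomial.X) ^ j

lemma negPowTaylor_succ (s : ℝ) (N : ℕ) :
    negPowTaylor s (N + 1) = negPowTaylor s N +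
      Polynomial.C (negBinomCoeff s (N + 1)) * (1 - Polynomial.X) ^ (N + 1) := by
  rw [negPowTaylor, Finset.sum_range_succ, negPowTaylor]

lemma natDegree_negPowTaylor_le (s : ℝ) (N : ℕ) : (negPowTaylor s N).natDegree ≤ N := by
  refine Polynomial.natDegree_sum_le_of_forall_le _ _ fun j hj => ?_
  have h1 : (1 - Polynomial.X : Polynomial ℝ).natDegree ≤ 1 := by compute_degree
  have h2 := Polynomial.natDegree_pow_le_of_le j h1
  have h3 := Polynomial.natDegree_C_mul_le (negBinomCoeff s j) ((1 - Polynomial.X) ^ j)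
  have := Finset.mem_range.mp hj
  lia

lemma negPowTaylor_eval_nonneg {s x : ℝ} (hs : 0 ≤ s) (hx : x ≤ 1) (N : ℕ) :
    0 ≤ (negPowTaylor s N).eval x := by
  rw [negPowTaylor, Polynomial.eval_finsetSum]
  refine Finset.sum_nonneg fun j _ => ?_
  have := negBinomCoeff_nonneg hs j
  have : 0 ≤ 1 - x := by linarith
  simp only [Polynomial.eval_mul, Polynomial.eval_C, Polynomial.eval_pow, Polynomial.eval_sub,
    Polynomial.eval_one, Polynomial.eval_X]
  positivity

lemma negPowTaylor_eval_one (s : ℝ) (N : ℕ) : (negPowTaylor s N).eval 1 = 1 := by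
  induction N with
  | zero => simp [negPowTaylor, negBinomCoeff]
  | succ N ih => simp [negPowTaylor_succ, ih]

/-- The truncated expansion satisfies the differential equation `s y + x y' = 0` of `x ^ (-s)`
up to a single term. -/
lemma negPowTaylor_ode (s : ℝ) (N : ℕ) (x : ℝ) :
    s * (negPowTaylor s N).eval x + x * (negPowTaylor s N).derivative.eval x =
      (s + N) * negBinomCoeff s N * (1 - x) ^ N := by
  induction N with
  | zero => simp [negPowTaylor, negBinomCoeff]
  | succ N ih =>
    have h := succ_mul_negBinomCoeff_succ s N
    simp only [negPowTaylor_succ, Polynomial.eval_add, Polynomial.derivative_add,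
      Polynomial.derivative_C_mul, Polynomial.derivative_pow_succ, Polynomial.derivative_sub,
      Polynomial.derivative_one, Polynomial.derivative_X, Polynomial.eval_mul,
      Polynomial.eval_C, Polynomial.eval_pow, Polynomial.eval_sub, Polynomial.eval_one,
      Polynomial.eval_X, Polynomial.eval_zero, Nat.cast_succ]
    linear_combination ih - (1 - x) ^ N * h

lemma hasDerivAt_rpow_mul_negPowTaylor (s : ℝ) (N : ℕ) {x : ℝ} (hx : 0 < x) :
    HasDerivAt (fun t => t ^ s * (negPowTaylor s N).eval t)
      (x ^ (s - 1) * ((s + N) * negBinomCoeff s N * (1 - x) ^ N)) x := by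
  have h := (Real.hasDerivAt_rpow_const (p := s) (Or.inl hx.ne')).mul
    ((negPowTaylor s N).hasDerivAt x)
  refine h.congr_deriv ?_
  rw [← negPowTaylor_ode]
  have : x ^ s = x ^ (s - 1) * x := by
    rw [← Real.rpow_add_one hx.ne']; ring_nf
  rw [this]; ring

lemma rpow_mul_negPowTaylor_le_one {s x : ℝ} (hs : 0 ≤ s) (N : ℕ) (hx : 0 < x) (hx1 : x ≤ 1) :
    x ^ s * (negPowTaylor s N).eval x ≤ 1 := by
  have hd : ∀ t ∈ Set.Icc x 1, HasDerivAt (fun t => t ^ s * (negPowTaylor s N).eval t)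
      (t ^ (s - 1) * ((s + N) * negBinomCoeff s N * (1 - t) ^ N)) t := fun t ht =>
    hasDerivAt_rpow_mul_negPowTaylor s N (hx.trans_le ht.1)
  have hmono : MonotoneOn (fun t => t ^ s * (negPowTaylor s N).eval t) (Set.Icc x 1) := by
    refine monotoneOn_of_hasDerivWithinAt_nonneg (convex_Icc _ _)
      (fun t ht => (hd t ht).continuousAt.continuousWithinAt)
      (fun t ht => (hd t (interior_subset ht)).hasDerivWithinAt) fun t ht => ?_
    have ht' := interior_subset ht
    have h0 : 0 < t := hx.trans_le ht'.1
    have h1 : 0 ≤ 1 - t := by linarith [ht'.2]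
    have := negBinomCoeff_nonneg hs N
    positivity
  simpa [negPowTaylor_eval_one] using
    hmono (Set.left_mem_Icc.2 hx1) (Set.right_mem_Icc.2 hx1) hx1

lemma one_sub_le_rpow_mul_negPowTaylor {s d x : ℝ} (hs : 0 ≤ s) (hs1 : s ≤ 1) (N : ℕ)
    (hd0 : 0 < d) (hx : d ≤ x) (hx1 : x ≤ 1) :
    1 - d⁻¹ * (1 - d) ^ (N + 1) ≤ x ^ s * (negPowTaylor s N).eval x := by
  have hd : ∀ t ∈ Set.Icc x 1, HasDerivAt
      (fun t => t ^ s * (negPowTaylor s N).eval t + d⁻¹ * (1 - t) ^ (N + 1))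
      (t ^ (s - 1) * ((s + N) * negBinomCoeff s N * (1 - t) ^ N) +
        d⁻¹ * (((N : ℝ) + 1) * (1 - t) ^ N * (-1))) t := fun t ht => by
    refine (hasDerivAt_rpow_mul_negPowTaylor s N (hd0.trans_le (hx.trans ht.1))).add ?_
    have := (((hasDerivAt_id t).const_sub 1).pow (N + 1)).const_mul d⁻¹
    simpa using this
  have hanti : AntitoneOn
      (fun t => t ^ s * (negPowTaylor s N).eval t + d⁻¹ * (1 - t) ^ (N + 1)) (Set.Icc x 1) := by
    refine antitoneOn_of_hasDerivWithinAt_nonpos (convex_Icc _ _)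
      (fun t ht => (hd t ht).continuousAt.continuousWithinAt)
      (fun t ht => (hd t (interior_subset ht)).hasDerivWithinAt) fun t ht => ?_
    have ht' := interior_subset ht
    have hdt : d ≤ t := hx.trans ht'.1
    have h0 : 0 < t := hd0.trans_le hdt
    have h1 : 0 ≤ 1 - t := by linarith [ht'.2]
    have hc := negBinomCoeff_nonneg hs N
    have hc1 := negBinomCoeff_le_one hs hs1 N
    have h2 : t ^ (s - 1) ≤ d⁻¹ := by
      calc t ^ (s - 1) ≤ t ^ (-1 : ℝ) :=
            Real.rpow_le_rpow_of_exponent_ge h0 ht'.2 (by linarith)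
        _ = t⁻¹ := Real.rpow_neg_one t
        _ ≤ d⁻¹ := inv_anti₀ hd0 hdt
    have h3 : (s + N) * negBinomCoeff s N ≤ (N : ℝ) + 1 := by
      have : (s + N) * negBinomCoeff s N ≤ (s + N) * 1 := by gcongr
      linarith
    have h4 : t ^ (s - 1) * ((s + N) * negBinomCoeff s N * (1 - t) ^ N) ≤
        d⁻¹ * (((N : ℝ) + 1) * (1 - t) ^ N) := by gcongr
    linarith
  have h := hanti (Set.left_mem_Icc.2 hx1) (Set.right_mem_Icc.2 hx1) hx1
  have h5 : d⁻¹ * (1 - x) ^ (N + 1) ≤ d⁻¹ * (1 - d) ^ (N + 1) := by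
    have : 0 ≤ 1 - x := by linarith
    gcongr
  simp only [negPowTaylor_eval_one, Real.one_rpow, sub_self, ne_eq, Nat.add_eq_zero_iff,
    one_ne_zero, and_false, not_false_eq_true, zero_pow, mul_zero, add_zero, mul_one] at h
  linarith

lemma monotoneOn_pow_mul_negPowTaylor {s : ℝ} {m : ℕ} (hs : 0 ≤ s) (hsm : s ≤ m) (N : ℕ) :
    MonotoneOn (fun x => (Polynomial.X ^ m * negPowTaylor s N).eval x) (Set.Icc 0 1) := by
  refine monotoneOn_of_hasDerivWithinAt_nonneg (convex_Icc _ _)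
    (Polynomial.continuous _).continuousOn
    (fun t _ => (Polynomial.hasDerivAt _ t).hasDerivWithinAt) fun t ht => ?_
  rw [interior_Icc] at ht
  have h1 : 0 ≤ 1 - t := by linarith [ht.2]
  have h0 : 0 ≤ t := ht.1.le
  have hc := negBinomCoeff_nonneg hs N
  have hS := negPowTaylor_eval_nonneg hs ht.2.le N
  have hode := negPowTaylor_ode s N t
  cases m with
  | zero =>
    have : s = 0 := le_antisymm (by simpa using hsm) hs
    subst this
    have h2 : 0 ≤ t * (negPowTaylor 0 N).derivative.eval t := by
      rw [zero_mul, zero_add] at hode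
      rw [hode]; positivity
    simpa using nonneg_of_mul_nonneg_right h2 ht.1
  | succ k =>
    have h2 : (Polynomial.X ^ (k + 1) * negPowTaylor s N).derivative.eval t =
        t ^ k * (((k + 1 : ℕ) - s) * (negPowTaylor s N).eval t +
          (s + N) * negBinomCoeff s N * (1 - t) ^ N) := by
      rw [← hode]
      simp only [Polynomial.derivative_mul, Polynomial.derivative_X_pow, Polynomial.eval_add,
        Polynomial.eval_mul, Polynomial.eval_pow, Polynomial.eval_X, Polynomial.eval_C,
        Nat.add_sub_cancel]
      push_cast
      ring
    rw [h2]
    have : 0 ≤ ((k + 1 : ℕ) : ℝ) - s := by linarith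
    positivity

/-- The approximation statement on the unit interval. -/
lemma exists_polynomial_approx_rpow_unit {p ε d : ℝ} (hp : 0 < p) (hε : 0 < ε) (hε1 : ε < 1)
    (hd : 0 < d) (hd1 : d < 1) :
    ∃ q : Polynomial ℝ,
      (q.natDegree : ℝ) ≤ 2 * (d⁻¹ * Real.log ((d * ε)⁻¹) + p + 1) ∧
      (∀ x ∈ Set.Icc d 1, |q.eval x - x ^ p| ≤ ε * x ^ p) ∧
      MonotoneOn (fun x => q.eval x) (Set.Icc 0 1) ∧ q.eval 0 = 0 := by
  set m := ⌈p⌉₊ with hm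
  set L := d⁻¹ * Real.log ((d * ε)⁻¹) with hL
  set N := ⌈L⌉₊ with hN
  have hm0 : m ≠ 0 := (Nat.ceil_pos.2 hp).ne'
  have hpm : p ≤ m := Nat.le_ceil p
  have hmp : (m : ℝ) < p + 1 := Nat.ceil_lt_add_one hp.le
  have hde : 0 < d * ε := by positivity
  have hL0 : 0 ≤ L := by
    have : 1 ≤ (d * ε)⁻¹ := (one_le_inv₀ hde).2 (by nlinarith)
    have := Real.log_nonneg this
    positivity
  have hLN : L ≤ N := Nat.le_ceil L
  have hNL : (N : ℝ) < L + 1 := Nat.ceil_lt_add_one hL0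
  have hs : 0 ≤ (m : ℝ) - p := by linarith
  have htail : d⁻¹ * (1 - d) ^ (N + 1) ≤ ε := by
    have h1 : (1 - d) ^ (N + 1) ≤ d * ε := by
      calc (1 - d) ^ (N + 1) ≤ (Real.exp (-d)) ^ (N + 1) :=
            pow_le_pow_left₀ (by linarith) (Real.one_sub_le_exp_neg d) _
        _ = Real.exp (((N + 1 : ℕ) : ℝ) * (-d)) := (Real.exp_nat_mul _ _).symm
        _ ≤ Real.exp (Real.log (d * ε)) := by
            apply Real.exp_le_exp.2
            have h2 : d * L = -Real.log (d * ε) := by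
              rw [hL, Real.log_inv, mul_inv_cancel_left₀ hd.ne']
            have h3 : d * L ≤ d * N := by gcongr
            push_cast
            linarith
        _ = d * ε := Real.exp_log hde
    rw [inv_mul_le_iff₀ hd]
    exact h1
  refine ⟨Polynomial.X ^ m * negPowTaylor (m - p) N, ?_, fun x hx => ?_,
    monotoneOn_pow_mul_negPowTaylor hs (by linarith) N, ?_⟩
  · have h1 : (Polynomial.X ^ m * negPowTaylor (m - p) N).natDegree ≤ m + N :=
      Polynomial.natDegree_mul_le.trans
        (add_le_add (Polynomial.natDegree_X_pow_le m) (natDegree_negPowTaylor_le _ _))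
    have h2 : ((Polynomial.X ^ m * negPowTaylor (m - p) N).natDegree : ℝ) ≤ m + N := by
      exact_mod_cast h1
    linarith
  · have hx0 : 0 < x := hd.trans_le hx.1
    have hle := rpow_mul_negPowTaylor_le_one hs N hx0 hx.2
    have hge := one_sub_le_rpow_mul_negPowTaylor hs (by linarith) N hd hx.1 hx.2
    have hxm : x ^ m = x ^ p * x ^ ((m : ℝ) - p) := by
      rw [← Real.rpow_add hx0, add_sub_cancel, Real.rpow_natCast]
    have hxp : 0 < x ^ p := Real.rpow_pos_of_pos hx0 p
    rw [Polynomial.eval_mul, Polynomial.eval_pow, Polynomial.eval_X, hxm,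
      show ∀ u v w : ℝ, u * v * w - u = (v * w - 1) * u by intros; ring, abs_mul,
      abs_of_pos hxp]
    gcongr
    rw [abs_le]
    constructor <;> linarith
  · simp [hm0]

/-- there is an absolute constant `C > 0` such that for all `p > 0`,
`ε ∈ (0,1)` and `0 < a < b ≤ 1` there is a real polynomial `q` of degree at most
`C·((b/a)·log(b/(a·ε)) + p + 1)` which `(1±ε)`-multiplicatively approximates `x ^ p`
on `[a,b]`, is nonnegative and nondecreasing on `[0,b]`, and vanishes at `0`. -/
theorem stmt_1 :
    ∃ C : ℝ, 0 < C ∧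
      ∀ p ε a b : ℝ, 0 < p → ε ∈ Set.Ioo (0 : ℝ) 1 → 0 < a → a < b → b ≤ 1 →
        ∃ q : Polynomial ℝ,
          (q.natDegree : ℝ) ≤ C * ((b / a) * Real.log (b / (a * ε)) + p + 1) ∧
          (∀ x ∈ Set.Icc a b, |q.eval x - x ^ p| ≤ ε * x ^ p) ∧
          (∀ x ∈ Set.Icc (0 : ℝ) b, 0 ≤ q.eval x) ∧
          (∀ x ∈ Set.Icc (0 : ℝ) b, ∀ y ∈ Set.Icc (0 : ℝ) b, x ≤ y →
            q.eval x ≤ q.eval y) ∧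
          q.eval 0 = 0 := by
  refine ⟨2, two_pos, fun p ε a b hp hε ha hab _ => ?_⟩
  have hb : 0 < b := ha.trans hab
  obtain ⟨q, hdeg, happ, hmono, hq0⟩ := exists_polynomial_approx_rpow_unit hp hε.1 hε.2
    (div_pos ha hb) ((div_lt_one hb).2 hab)
  have heval : ∀ x, (Polynomial.C (b ^ p) * q.comp (Polynomial.C b⁻¹ * Polynomial.X)).eval x =
      b ^ p * q.eval (x / b) := fun x => by
    simp [Polynomial.eval_comp, div_eq_inv_mul]
  have hbp : 0 < b ^ p := Real.rpow_pos_of_pos hb p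
  have hmem : ∀ x ∈ Set.Icc (0 : ℝ) b, x / b ∈ Set.Icc (0 : ℝ) 1 := fun x hx =>
    ⟨div_nonneg hx.1 hb.le, (div_le_one hb).2 hx.2⟩
  have hmono' : ∀ x ∈ Set.Icc (0 : ℝ) b, ∀ y ∈ Set.Icc (0 : ℝ) b, x ≤ y →
      b ^ p * q.eval (x / b) ≤ b ^ p * q.eval (y / b) := fun x hx y hy hxy =>
    mul_le_mul_of_nonneg_left (hmono (hmem x hx) (hmem y hy) (by gcongr)) hbp.le
  refine ⟨Polynomial.C (b ^ p) * q.comp (Polynomial.C b⁻¹ * Polynomial.X), ?_, ?_, ?_, ?_, ?_⟩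
  · have h1 : (Polynomial.C (b ^ p) * q.comp (Polynomial.C b⁻¹ * Polynomial.X)).natDegree ≤
        q.natDegree := by
      refine (Polynomial.natDegree_C_mul_le _ _).trans (Polynomial.natDegree_comp_le.trans ?_)
      exact mul_le_of_le_one_right (Nat.zero_le _)
        ((Polynomial.natDegree_C_mul_le _ _).trans Polynomial.natDegree_X_le)
    have h2 : (a / b)⁻¹ * Real.log ((a / b * ε)⁻¹) = b / a * Real.log (b / (a * ε)) := by
      rw [inv_div]
      congr 2
      rw [div_mul_eq_mul_div, inv_div]
    rw [h2] at hdeg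
    exact (Nat.cast_le.2 h1).trans hdeg
  · intro x hx
    have hx0 : 0 ≤ x := ha.le.trans hx.1
    have h := happ (x / b) ⟨by gcongr; exact hx.1, (div_le_one hb).2 hx.2⟩
    have hxp : x ^ p = b ^ p * (x / b) ^ p := by
      rw [← Real.mul_rpow hb.le (div_nonneg hx0 hb.le), mul_div_cancel₀ _ hb.ne']
    rw [heval, hxp, ← mul_sub, abs_mul, abs_of_pos hbp, mul_left_comm]
    gcongr
  · intro x hx
    have h := hmono' 0 ⟨le_rfl, hb.le⟩ x hx hx.1
    rw [heval]
    simpa [hq0] using h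
  · intro x hx y hy hxy
    rw [heval, heval]
    exact hmono' x hx y hy hxy
  · simp [heval, hq0]
end

section
/- Let 0 < a < b, let δ ≥ 1, and let f : ℝ → ℝ be differentiable on [a,b] with f(z) > 0 for all z ∈ [a,b] and |f'(z)| ≤ δ·f(z)/z for all z ∈ [a,b]. Then for every c ∈ (0, 1/(3δ)) and every x, y ∈ [a,b] with (1-c)·x ≤ y ≤ (1+c)·x, one has (1 - 3δc)·f(x) ≤ f(y) ≤ (1 + 3δc)·f(x). -/
/-- multiplicative smoothness implies multiplicative stability.
If `f` is differentiable on `[a,b]`, positive there, and `|f'(z)| ≤ δ·f(z)/z`,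
then for `c ∈ (0, 1/(3δ))` and `y ∈ [(1-c)x, (1+c)x]` (with `x, y ∈ [a,b]`) we have
`f(y) ∈ [(1-3δc)·f(x), (1+3δc)·f(x)]`. -/
theorem stmt_2 (a b δ c x y : ℝ) (f f' : ℝ → ℝ)
    (ha : 0 < a) (hab : a < b) (hδ : 1 ≤ δ)
    (hderiv : ∀ z ∈ Set.Icc a b, HasDerivWithinAt f (f' z) (Set.Icc a b) z)
    (hpos : ∀ z ∈ Set.Icc a b, 0 < f z)
    (hbound : ∀ z ∈ Set.Icc a b, |f' z| ≤ δ * f z / z)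
    (hc : c ∈ Set.Ioo (0 : ℝ) (1 / (3 * δ)))
    (hx : x ∈ Set.Icc a b) (hy : y ∈ Set.Icc a b)
    (hy1 : (1 - c) * x ≤ y) (hy2 : y ≤ (1 + c) * x) :
    (1 - 3 * δ * c) * f x ≤ f y ∧ f y ≤ (1 + 3 * δ * c) * f x := by
  obtain ⟨hc0, hc1⟩ := hc
  have hδ0 : 0 < δ := by linarith
  have hx0 : 0 < x := ha.trans_le hx.1
  have hδc : 3 * δ * c < 1 := by
    rw [lt_div_iff₀ (by positivity)] at hc1
    linarith
  have hc3 : c < 1 / 3 := by nlinarith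
  have hfx := hpos x hx
  have hfy := hpos y hy
  have hsub : Set.uIcc x y ⊆ Set.Icc a b := Set.uIcc_subset_Icc hx hy
  have hlog : |Real.log (f y) - Real.log (f x)| ≤ 3 / 2 * δ * c := by
    have hmvt : ‖Real.log (f y) - Real.log (f x)‖ ≤ δ / (2 / 3 * x) * ‖y - x‖ := by
      refine (convex_uIcc x y).norm_image_sub_le_of_norm_hasDerivWithin_le
        (f := fun z => Real.log (f z)) (f' := fun z => f' z / f z)
        (fun z hz => ((hderiv z (hsub hz)).mono hsub).log (hpos z (hsub hz)).ne')
        (fun z hz => ?_) Set.left_mem_uIcc Set.right_mem_uIcc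
      have hfz := hpos z (hsub hz)
      have hz0 : 0 < z := ha.trans_le (hsub hz).1
      have hzx : 2 / 3 * x ≤ z :=
        (le_min (by linarith) (by nlinarith)).trans hz.1
      rw [Real.norm_eq_abs, abs_div, abs_of_pos hfz]
      calc |f' z| / f z ≤ δ * f z / z / f z := by gcongr; exact hbound z (hsub hz)
        _ = δ / z := by field_simp
        _ ≤ δ / (2 / 3 * x) := by gcongr
    have hyx : ‖y - x‖ ≤ c * x := by
      rw [Real.norm_eq_abs, abs_le]
      constructor <;> linarith
    calc |Real.log (f y) - Real.log (f x)| ≤ δ / (2 / 3 * x) * (c * x) :=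
          hmvt.trans (by gcongr)
      _ = 3 / 2 * δ * c := by field_simp
  rw [← Real.log_div hfy.ne' hfx.ne', abs_le] at hlog
  rw [← le_div_iff₀ hfx, ← div_le_iff₀ hfx]
  have hq : 0 < f y / f x := div_pos hfy hfx
  have ht : 0 < δ * c := by positivity
  have hlower := Real.log_le_sub_one_of_pos hq
  have hupper := Real.one_sub_inv_le_log_of_pos hq
  refine ⟨by linarith, ?_⟩
  have hinv : (1 - 3 / 2 * δ * c) * (f y / f x) ≤ 1 := by
    calc (1 - 3 / 2 * δ * c) * (f y / f x) ≤ (f y / f x)⁻¹ * (f y / f x) := by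
          gcongr
          linarith
      _ = 1 := inv_mul_cancel₀ hq.ne'
  have hpos' : 0 < 1 - 3 / 2 * δ * c := by linarith
  refine le_of_mul_le_mul_left (hinv.trans ?_) hpos'
  nlinarith
end

section
/- Let α ∈ (0,1), let γ ∈ (0, α/4], and let x ∈ (0,1]. Then the Lebesgue measure of the set { a ∈ [1-α, 1] : there exists t ∈ ℕ with (1-γ)·x ≤ a·(1-α)^t ≤ (1+γ)·x } is at most 8γ. Equivalently, if a is chosen uniformly at random from [1-α, 1], the probability that some point a·(1-α)^t of the random geometric grid lies within multiplicative factor (1±γ) of x is at most 8γ/α. -/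
/-- The points `a ≤ 1` for which `a * p` is within a factor `1 ± γ` of `x` have measure at most
`4 * γ`. -/
theorem volume_le_one_mul_near_le {γ x p : ℝ} (hγ : 0 < γ) (hγ2 : γ ≤ 1 / 2) (hx : 0 < x)
    (hp : 0 < p) :
    MeasureTheory.volume {a : ℝ | a ≤ 1 ∧ (1 - γ) * x ≤ a * p ∧ a * p ≤ (1 + γ) * x}
      ≤ ENNReal.ofReal (4 * γ) := by
  rcases Set.eq_empty_or_nonempty
    {a : ℝ | a ≤ 1 ∧ (1 - γ) * x ≤ a * p ∧ a * p ≤ (1 + γ) * x} with h | ⟨b, hb1, hb2, -⟩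
  · simp [h]
  · have hxp : x / p ≤ 2 := by
      rw [div_le_iff₀ hp]
      nlinarith
    calc _ ≤ MeasureTheory.volume (Set.Icc ((1 - γ) * x / p) ((1 + γ) * x / p)) := by
          refine MeasureTheory.measure_mono ?_
          rintro a ⟨-, h1, h2⟩
          exact ⟨(div_le_iff₀ hp).2 h1, (le_div_iff₀ hp).2 h2⟩
      _ ≤ ENNReal.ofReal (4 * γ) := by
          rw [Real.volume_Icc]
          refine ENNReal.ofReal_le_ofReal ?_
          have : (1 + γ) * x / p - (1 - γ) * x / p = 2 * γ * (x / p) := by ring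
          rw [this]
          nlinarith

/-- Two grid points with shifts in `[1 - α, 1]` that are both within a factor `1 ± γ` of `x` have
exponents differing by at most one. -/
theorem exponent_le_succ_of_near {α γ x a b : ℝ} {s t : ℕ} (hα : α ∈ Set.Ioo (0 : ℝ) 1)
    (hγ : 0 < γ) (hγ2 : γ ≤ α / 4) (ha : 1 - α ≤ a) (hb : b ≤ 1)
    (has : a * (1 - α) ^ s ≤ (1 + γ) * x) (hbt : (1 - γ) * x ≤ b * (1 - α) ^ t) :
    t ≤ s + 1 := by
  obtain ⟨hα0, hα1⟩ := hα
  by_contra! hst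
  have hr : 0 < 1 - α := by linarith
  have hs : 0 < (1 - α) ^ (s + 1) := pow_pos hr _
  have hpow : (1 - α) ^ t ≤ (1 - α) ^ (s + 1) * (1 - α) := by
    rw [← pow_succ]
    exact pow_le_pow_of_le_one hr.le (by linarith) hst
  have lower : (1 - α) ^ (s + 1) ≤ (1 + γ) * x := by
    rw [pow_succ']
    exact (mul_le_mul_of_nonneg_right ha (pow_pos hr s).le).trans has
  have upper : (1 - γ) * x ≤ (1 - α) ^ (s + 1) * (1 - α) :=
    hbt.trans ((mul_le_of_le_one_left (pow_pos hr t).le hb).trans hpow)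
  have h1 := mul_le_mul_of_nonneg_left lower (by linarith : 0 ≤ 1 - γ)
  have h2 := mul_le_mul_of_nonneg_left upper (by linarith : 0 ≤ 1 + γ)
  have h3 : (1 - α) ^ (s + 1) * (1 - γ) ≤ (1 - α) ^ (s + 1) * ((1 - α) * (1 + γ)) := by
    linarith
  have h4 := le_of_mul_le_mul_left h3 hs
  nlinarith [mul_pos hα0 hγ]

/-- random-shift boundary-crossing bound. For `α ∈ (0,1)`, `γ ∈ (0, α/4]`
and `x ∈ (0,1]`, the Lebesgue measure of the set of shifts `a ∈ [1-α,1]` for which some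
grid point `a·(1-α)^t` lands within a multiplicative `(1±γ)` factor of `x` is at most `8γ`. -/
theorem stmt_4 (α γ x : ℝ) (hα : α ∈ Set.Ioo (0 : ℝ) 1) (hγ : 0 < γ) (hγ2 : γ ≤ α / 4)
    (hx : x ∈ Set.Ioc (0 : ℝ) 1) :
    MeasureTheory.volume
      {a : ℝ | a ∈ Set.Icc (1 - α) 1 ∧
        ∃ t : ℕ, (1 - γ) * x ≤ a * (1 - α) ^ t ∧ a * (1 - α) ^ t ≤ (1 + γ) * x}
      ≤ ENNReal.ofReal (8 * γ) := by
  classical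
  have hr : 0 < 1 - α := by linarith [hα.2]
  have hγ' : γ ≤ 1 / 2 := by linarith [hα.2]
  by_cases hit : ∃ t : ℕ, ∃ a : ℝ, a ∈ Set.Icc (1 - α) 1 ∧
      (1 - γ) * x ≤ a * (1 - α) ^ t ∧ a * (1 - α) ^ t ≤ (1 + γ) * x
  · obtain ⟨b, hb, -, hbs⟩ := Nat.find_spec hit
    set s := Nat.find hit
    let S : ℕ → Set ℝ := fun t =>
      {a : ℝ | a ≤ 1 ∧ (1 - γ) * x ≤ a * (1 - α) ^ t ∧ a * (1 - α) ^ t ≤ (1 + γ) * x}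
    have hS (t : ℕ) : MeasureTheory.volume (S t) ≤ ENNReal.ofReal (4 * γ) :=
      volume_le_one_mul_near_le hγ hγ' hx.1 (pow_pos hr t)
    calc _ ≤ MeasureTheory.volume (S s ∪ S (s + 1)) := by
          refine MeasureTheory.measure_mono ?_
          rintro a ⟨ha, t, h1, h2⟩
          have hst : s ≤ t := Nat.find_min' hit ⟨a, ha, h1, h2⟩
          have hts : t ≤ s + 1 := exponent_le_succ_of_near hα hγ hγ2 hb.1 ha.2 hbs h1
          obtain rfl | rfl : t = s ∨ t = s + 1 := by omega
          · exact Or.inl ⟨ha.2, h1, h2⟩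
          · exact Or.inr ⟨ha.2, h1, h2⟩
      _ ≤ ENNReal.ofReal (4 * γ) + ENNReal.ofReal (4 * γ) :=
          (MeasureTheory.measure_union_le _ _).trans (add_le_add (hS _) (hS _))
      _ = ENNReal.ofReal (8 * γ) := by
          rw [← ENNReal.ofReal_add (by positivity) (by positivity)]
          ring_nf
  · refine (MeasureTheory.measure_mono_null ?_ MeasureTheory.measure_empty).trans_le zero_le
    rintro a ⟨ha, t, h⟩
    exact hit ⟨t, a, ha, h⟩
end

section
/- Let G be a simple graph on n ≥ 1 vertices with real adjacency matrix A (symmetric, zero diagonal, entries in {0,1}). Let h > 0, let (c_k)_{k∈ℕ} be real coefficients with |c_k| ≤ |c_3|·h^{k-3} for all k ≥ 4, and let f : ℝ → ℝ satisfy f(x) = Σ_{k=0}^∞ c_k (x-1)^k (a convergent series) for every x ∈ (0,2) with |x-1| ≤ 1/(10h). Set δ = min(1/n, 1/(10·n^4·h)). Then all eigenvalues of I + δA lie in (0,2), and |Σ_{i=1}^n f(λ_i(I + δA)) - ( c_0·n + c_2·δ²·tr(A²) + c_3·δ³·tr(A³) )| ≤ |c_3|·δ³/9, where λ_1, …, λ_n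 are the eigenvalues of I + δA. -/
/-- Power sums of shifted eigenvalues are traces of powers of the shifted matrix. -/
theorem Matrix.IsHermitian.sum_eigenvalues_sub_one_pow {ι : Type*} [Fintype ι] [DecidableEq ι]
    {B : Matrix ι ι ℝ} (hB : B.IsHermitian) (k : ℕ) :
    ∑ i, (hB.eigenvalues i - 1) ^ k = Matrix.trace ((B - 1) ^ k) := by
  have hconj : (B - 1) ^ k = Unitary.conjStarAlgAut ℝ (Matrix ι ι ℝ) hB.eigenvectorUnitary
      (Matrix.diagonal fun i => (hB.eigenvalues i - 1) ^ k) := by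
    have hdiag : (Matrix.diagonal fun i => (hB.eigenvalues i - 1) ^ k)
        = (Matrix.diagonal (RCLike.ofReal ∘ hB.eigenvalues) - 1 : Matrix ι ι ℝ) ^ k := by
      rw [← Matrix.diagonal_one, Matrix.diagonal_sub, Matrix.diagonal_pow]
      rfl
    rw [hdiag, map_pow, map_sub, map_one, ← hB.spectral_theorem]
  rw [hconj, Unitary.conjStarAlgAut_apply, Matrix.trace_mul_comm, ← mul_assoc,
    Unitary.coe_star_mul_self, one_mul, Matrix.trace_diagonal]

theorem SimpleGraph.trace_adjMatrix_sq_le {n : ℕ} (G : SimpleGraph (Fin n))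
    [DecidableRel G.Adj] :
    Matrix.trace ((G.adjMatrix ℝ) ^ 2) ≤ (n : ℝ) * (n - 1) := by
  have hdeg : ∀ i : Fin n, ((G.adjMatrix ℝ) ^ 2) i i ≤ (n : ℝ) - 1 := by
    intro i
    rw [pow_two, SimpleGraph.adjMatrix_mul_self_apply_self]
    have hlt := G.degree_lt_card_verts i
    rw [Fintype.card_fin] at hlt
    have : (G.degree i : ℝ) + 1 ≤ n := by exact_mod_cast hlt
    linarith
  calc Matrix.trace ((G.adjMatrix ℝ) ^ 2) ≤ ∑ _i : Fin n, ((n : ℝ) - 1) :=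
        Finset.sum_le_sum fun i _ => hdeg i
    _ = n * (n - 1) := by simp [mul_sub]

/-- Cubic Taylor remainder of a power series whose coefficients grow geometrically from
the cubic one on. -/
theorem abs_sub_cubic_le_of_hasSum {c : ℕ → ℝ} {h y s : ℝ} (hh : 0 < h)
    (hc : ∀ k : ℕ, 4 ≤ k → |c k| ≤ |c 3| * h ^ (k - 3))
    (hs : HasSum (fun k : ℕ => c k * y ^ k) s) (hy : h * |y| ≤ 1 / 10) :
    |s - (c 0 + c 1 * y + c 2 * y ^ 2 + c 3 * y ^ 3)| ≤ 10 / 9 * |c 3| * h * y ^ 4 := by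
  have hq : 0 ≤ h * |y| := by positivity
  have htail := (hasSum_nat_add_iff' 4).mpr hs
  have hgeom := (hasSum_geometric_of_lt_one hq (by linarith)).mul_left (|c 3| * h * y ^ 4)
  have hterm : ∀ k, ‖c (k + 4) * y ^ (k + 4)‖ ≤ |c 3| * h * y ^ 4 * (h * |y|) ^ k := by
    intro k
    have hk := hc (k + 4) (by omega)
    rw [show k + 4 - 3 = k + 1 by omega] at hk
    rw [Real.norm_eq_abs, abs_mul, abs_pow]
    calc |c (k + 4)| * |y| ^ (k + 4) ≤ |c 3| * h ^ (k + 1) * |y| ^ (k + 4) := by gcongr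
      _ = |c 3| * h * |y| ^ 4 * (h * |y|) ^ k := by ring
      _ = |c 3| * h * y ^ 4 * (h * |y|) ^ k := by rw [Even.pow_abs (by decide)]
  have hbound := tsum_of_norm_bounded hgeom hterm
  rw [htail.tsum_eq, Real.norm_eq_abs] at hbound
  have hinv : (1 - h * |y|)⁻¹ ≤ 10 / 9 := by
    rw [inv_le_comm₀ (by linarith) (by norm_num)]
    linarith
  have hpoly : ∑ k ∈ Finset.range 4, c k * y ^ k
      = c 0 + c 1 * y + c 2 * y ^ 2 + c 3 * y ^ 3 := by
    simp [Finset.sum_range_succ]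
  rw [hpoly] at hbound
  calc _ ≤ |c 3| * h * y ^ 4 * (1 - h * |y|)⁻¹ := hbound
    _ ≤ |c 3| * h * y ^ 4 * (10 / 9) := by gcongr
    _ = _ := by ring

/-- for a simple graph `G` on `n ≥ 1` vertices with adjacency matrix `A`,
coefficients `c_k` dominated by `|c_3|·h^{k-3}` for `k ≥ 4`, and `f` given by the power
series `∑ c_k (x-1)^k` near `1`, with `δ = min(1/n, 1/(10 n⁴ h))`, all eigenvalues of
`I + δA` lie in `(0,2)` and the spectral sum of `f` over `I + δA` equals
`c₀·n + c₂·δ²·tr(A²) + c₃·δ³·tr(A³)` up to additive error `|c₃|·δ³/9`. -/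
theorem stmt_5 (n : ℕ) (hn : 1 ≤ n) (G : SimpleGraph (Fin n)) [DecidableRel G.Adj]
    (h : ℝ) (hh : 0 < h) (c : ℕ → ℝ)
    (hc : ∀ k : ℕ, 4 ≤ k → |c k| ≤ |c 3| * h ^ (k - 3))
    (f : ℝ → ℝ)
    (hf : ∀ x ∈ Set.Ioo (0 : ℝ) 2, |x - 1| ≤ 1 / (10 * h) →
      HasSum (fun k : ℕ => c k * (x - 1) ^ k) (f x))
    (δ : ℝ) (hδ : δ = min (1 / (n : ℝ)) (1 / (10 * (n : ℝ) ^ 4 * h)))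
    (hH : ((1 : Matrix (Fin n) (Fin n) ℝ) + δ • G.adjMatrix ℝ).IsHermitian) :
    (∀ i, hH.eigenvalues i ∈ Set.Ioo (0 : ℝ) 2) ∧
    |(∑ i, f (hH.eigenvalues i)) -
        (c 0 * n + c 2 * δ ^ 2 * Matrix.trace ((G.adjMatrix ℝ) ^ 2)
          + c 3 * δ ^ 3 * Matrix.trace ((G.adjMatrix ℝ) ^ 3))|
      ≤ |c 3| * δ ^ 3 / 9 := by
  have hn1 : (1 : ℝ) ≤ n := by exact_mod_cast hn
  have hn0 : (0 : ℝ) < n := by linarith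
  have hδ0 : 0 < δ := by rw [hδ]; positivity
  have hδn : δ * n ≤ 1 := by
    rw [← le_div_iff₀ hn0, hδ]
    exact min_le_left _ _
  have hδh : 10 * n ^ 4 * h * δ ≤ 1 := by
    rw [mul_comm, ← le_div_iff₀ (by positivity), hδ]
    exact min_le_right _ _
  set y : Fin n → ℝ := fun i => hH.eigenvalues i - 1 with hy
  have hsum : ∀ k, ∑ i, y i ^ k = δ ^ k * Matrix.trace ((G.adjMatrix ℝ) ^ k) := by
    intro k
    rw [hy, hH.sum_eigenvalues_sub_one_pow, add_sub_cancel_left, smul_pow, Matrix.trace_smul,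
      smul_eq_mul]
  have hsum_one : ∑ i, y i = 0 := by
    simpa [SimpleGraph.trace_adjMatrix] using hsum 1
  have hsum_sq : ∑ i, y i ^ 2 < (δ * n) ^ 2 := by
    rw [hsum 2, mul_pow]
    have := G.trace_adjMatrix_sq_le
    gcongr
    nlinarith
  have hsq : ∀ i, y i ^ 2 < (δ * n) ^ 2 := fun i =>
    (Finset.single_le_sum (f := fun i => y i ^ 2) (fun j _ => sq_nonneg (y j))
      (Finset.mem_univ i)).trans_lt hsum_sq
  have habs : ∀ i, |y i| < δ * n := fun i => abs_lt_of_sq_lt_sq (hsq i) (by positivity)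
  have hmem : ∀ i, hH.eigenvalues i ∈ Set.Ioo (0 : ℝ) 2 := by
    intro i
    have := abs_lt.mp ((habs i).trans_le hδn)
    simp only [hy] at this
    constructor <;> linarith [this.1, this.2]
  have hsmall : ∀ i, h * |y i| ≤ 1 / 10 := by
    intro i
    have hpow : (n : ℝ) ≤ n ^ 4 := le_self_pow₀ hn1 (by norm_num)
    calc h * |y i| ≤ h * (δ * n) := by gcongr; exact (habs i).le
      _ ≤ h * (δ * n ^ 4) := by gcongr
      _ ≤ 1 / 10 := by linarith
  have hrem : ∀ i, |f (hH.eigenvalues i) -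
      (c 0 + c 1 * y i + c 2 * y i ^ 2 + c 3 * y i ^ 3)| ≤ 10 / 9 * |c 3| * h * y i ^ 4 := by
    intro i
    refine abs_sub_cubic_le_of_hasSum hh hc (hf _ (hmem i) ?_) (hsmall i)
    rw [le_div_iff₀ (by positivity)]
    linarith [hsmall i]
  have hsum_four : ∑ i, y i ^ 4 ≤ (δ * n) ^ 4 := by
    calc ∑ i, y i ^ 4 ≤ ∑ i, (δ * n) ^ 2 * y i ^ 2 := by
          refine Finset.sum_le_sum fun i _ => ?_
          rw [show y i ^ 4 = y i ^ 2 * y i ^ 2 by ring]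
          exact mul_le_mul_of_nonneg_right (hsq i).le (sq_nonneg _)
      _ = (δ * n) ^ 2 * ∑ i, y i ^ 2 := by rw [Finset.mul_sum]
      _ ≤ (δ * n) ^ 2 * (δ * n) ^ 2 := by gcongr
      _ = (δ * n) ^ 4 := by ring
  refine ⟨hmem, ?_⟩
  have hmain : c 0 * n + c 2 * δ ^ 2 * Matrix.trace ((G.adjMatrix ℝ) ^ 2)
      + c 3 * δ ^ 3 * Matrix.trace ((G.adjMatrix ℝ) ^ 3)
      = ∑ i, (c 0 + c 1 * y i + c 2 * y i ^ 2 + c 3 * y i ^ 3) := by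
    simp only [Finset.sum_add_distrib, ← Finset.mul_sum, hsum_one, hsum 2, hsum 3]
    simp
    ring
  rw [hmain, ← Finset.sum_sub_distrib]
  calc _ ≤ ∑ i, 10 / 9 * |c 3| * h * y i ^ 4 :=
        (Finset.abs_sum_le_sum_abs _ _).trans (Finset.sum_le_sum fun i _ => hrem i)
    _ = 10 / 9 * |c 3| * h * ∑ i, y i ^ 4 := by rw [Finset.mul_sum]
    _ ≤ 10 / 9 * |c 3| * h * (δ * n) ^ 4 := by gcongr
    _ = |c 3| * δ ^ 3 / 9 * (10 * n ^ 4 * h * δ) := by ring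
    _ ≤ |c 3| * δ ^ 3 / 9 := mul_le_of_le_one_right (by positivity) hδh
end

section
/- Let n ≥ 3, let σ_1, …, σ_n be nonnegative reals with S := Σ_i σ_i > 0, let ε ∈ (0,1), and let Z be a real with S ≤ Z ≤ (1+ε)·S. Define H(c) = -Σ_{i=1}^n (σ_i/c)·log(σ_i/c) for c > 0 (with the convention 0·log 0 = 0, and log the natural logarithm). Then |H(Z) - H(S)| ≤ 2·ε·log n. -/
/-- The entropy of a probability vector of length `n` is at most `log n`. -/
theorem neg_sum_mul_log_le_log_card {n : ℕ} (hn : 0 < n) (p : Fin n → ℝ) (hp : ∀ i, 0 ≤ p i)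
    (hsum : ∑ i, p i = 1) : -∑ i, p i * Real.log (p i) ≤ Real.log n := by
  have hn' : (0 : ℝ) < n := by exact_mod_cast hn
  have key : ∀ i, -(p i * Real.log (p i)) ≤ (1 / n - p i) + p i * Real.log n := by
    intro i
    rcases (hp i).eq_or_lt with h | h
    · rw [← h]
      simp
    · have hlog := Real.log_le_sub_one_of_pos (show 0 < (n * p i)⁻¹ by positivity)
      rw [Real.log_inv, Real.log_mul hn'.ne' h.ne'] at hlog
      have hmul := mul_le_mul_of_nonneg_left hlog h.le
      have hcancel : p i * ((n * p i)⁻¹ - 1) = 1 / n - p i := by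
        field_simp
      rw [hcancel] at hmul
      linarith
  calc -∑ i, p i * Real.log (p i) = ∑ i, -(p i * Real.log (p i)) := by
        rw [Finset.sum_neg_distrib]
    _ ≤ ∑ i, ((1 / n - p i) + p i * Real.log n) := Finset.sum_le_sum fun i _ => key i
    _ = Real.log n := by
        rw [Finset.sum_add_distrib, Finset.sum_sub_distrib, ← Finset.sum_mul, hsum]
        simp [hn'.ne']

/-- Rescaling a vector of total mass one by `r⁻¹` acts affinely on its entropy. -/
theorem neg_sum_div_mul_log_div {n : ℕ} (p : Fin n → ℝ) (hsum : ∑ i, p i = 1) {r : ℝ}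
    (hr : r ≠ 0) : -∑ i, p i / r * Real.log (p i / r) =
      (-∑ i, p i * Real.log (p i)) / r + Real.log r / r := by
  have key : ∀ i, p i / r * Real.log (p i / r) =
      p i * Real.log (p i) / r - p i * (Real.log r / r) := by
    intro i
    by_cases h : p i = 0
    · simp [h]
    · rw [Real.log_div h hr]
      ring
  rw [Finset.sum_congr rfl fun i _ => key i, Finset.sum_sub_distrib, ← Finset.sum_mul, hsum,
    ← Finset.sum_div]
  ring


/-- replacing the normalizer `S = ∑ σᵢ` of the entropy
`H(c) = -∑ (σᵢ/c)·log(σᵢ/c)` by a `(1+ε)`-approximation `Z` changes the entropy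
by at most `2·ε·log n`. -/
theorem stmt_10 (n : ℕ) (hn : 3 ≤ n) (σ : Fin n → ℝ) (hσ : ∀ i, 0 ≤ σ i)
    (S : ℝ) (hS : S = ∑ i, σ i) (hSpos : 0 < S)
    (ε : ℝ) (hε : ε ∈ Set.Ioo (0 : ℝ) 1)
    (Z : ℝ) (hZ1 : S ≤ Z) (hZ2 : Z ≤ (1 + ε) * S)
    (H : ℝ → ℝ) (hH : ∀ c : ℝ, 0 < c → H c = -∑ i, σ i / c * Real.log (σ i / c)) :
    |H Z - H S| ≤ 2 * ε * Real.log n := by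
  obtain ⟨hε0, -⟩ := hε
  have hZpos : 0 < Z := hSpos.trans_le hZ1
  have hp : ∀ i, 0 ≤ σ i / S := fun i => div_nonneg (hσ i) hSpos.le
  have hsum : ∑ i, σ i / S = 1 := by
    rw [← Finset.sum_div, ← hS, div_self hSpos.ne']
  have hp1 : ∀ i, σ i / S ≤ 1 := fun i => by
    rw [← hsum]
    exact Finset.single_le_sum (fun j _ => hp j) (Finset.mem_univ i)
  have hr1 : 1 ≤ Z / S := (one_le_div hSpos).2 hZ1
  have hr2 : Z / S ≤ 1 + ε := (div_le_iff₀ hSpos).2 hZ2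
  have hHS0 : 0 ≤ H S := by
    rw [hH S hSpos, neg_nonneg]
    exact Finset.sum_nonpos fun i _ =>
      mul_nonpos_of_nonneg_of_nonpos (hp i) (Real.log_nonpos (hp i) (hp1 i))
  have hHS1 : H S ≤ Real.log n := by
    rw [hH S hSpos]
    exact neg_sum_mul_log_le_log_card (by omega) _ hp hsum
  have hHZ : H Z = H S / (Z / S) + Real.log (Z / S) / (Z / S) := by
    rw [hH S hSpos, ← neg_sum_div_mul_log_div _ hsum (by positivity), hH Z hZpos]
    simp only [div_div_div_cancel_right₀ hSpos.ne']
  have hlogn : 1 ≤ Real.log n := by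
    rw [Real.le_log_iff_exp_le (by positivity)]
    have h3 : (3 : ℝ) ≤ n := by exact_mod_cast hn
    linarith [Real.exp_one_lt_d9]
  generalize Z / S = r at hr1 hr2 hHZ
  have hr0 : 0 < r := by linarith
  have hlogr0 : 0 ≤ Real.log r := Real.log_nonneg hr1
  have hlogr1 : Real.log r ≤ ε := by linarith [Real.log_le_sub_one_of_pos hr0]
  have hquot0 : 0 ≤ Real.log r / r := by positivity
  have hquot1 : Real.log r / r ≤ Real.log r := div_le_self hlogr0 hr1
  have hdiv : H S / r ≤ H S := div_le_self hHS0 hr1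
  have hεlog : ε ≤ ε * Real.log n := le_mul_of_one_le_right hε0.le hlogn
  have hloss : H S - H S / r ≤ ε * Real.log n := by
    have hinv : 1 - r⁻¹ ≤ ε := by
      have hlog := Real.one_sub_inv_le_log_of_pos hr0
      linarith
    calc H S - H S / r = (1 - r⁻¹) * H S := by ring
      _ ≤ ε * Real.log n := mul_le_mul hinv hHS1 hHS0 hε0.le
  rw [abs_le]
  constructor <;> linarith
end

section
/- Let A be an n×d real matrix all of whose rows a_1, …, a_n ∈ ℝ^d are nonzero, and let λ > 0. Then for every y ∈ ℝ^d, Σ_{i=1}^n (‖A‖_F² / ‖a_i‖₂²) · ‖( a_i a_iᵀ + (λ‖a_i‖₂²/‖A‖_F²)·I ) y‖₂² ≤ (‖A‖_F² + 2λ) · yᵀ (AᵀA + λI) y. (Taking y = x - x* with x* = (AᵀA + λI)⁻¹ b, this is the SVRG variance bound: the importance-weighted sum of squared stochastic gradient differences of ψ_i(x) = ½xᵀ(a_i a_iᵀ + (λ‖a_i‖₂²/‖A‖_F²)I)x - (1/n)bᵀx, with sampling probabilities p_i = ‖a_i‖₂²/‖A‖_F², is at most 2(‖A‖_F² + 2λ)[f(x)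 - f(x*)] for the ridge objective f(x) = ½xᵀ(AᵀA+λI)x - bᵀx.) -/
open Matrix

/-- Squared norm of `(a aᵀ + c I) y`, expanded. -/
theorem sum_sq_vecMulVec_add_smul_one_mulVec {d : ℕ} (a y : Fin d → ℝ) (c : ℝ) :
    ∑ j, ((vecMulVec a a + c • (1 : Matrix (Fin d) (Fin d) ℝ)).mulVec y j) ^ 2
      = (∑ j, a j ^ 2) * (a ⬝ᵥ y) ^ 2 + 2 * c * (a ⬝ᵥ y) ^ 2 + c ^ 2 * ∑ j, y j ^ 2 := by
  have hentry : ∀ j, (vecMulVec a a + c • (1 : Matrix (Fin d) (Fin d) ℝ)).mulVec y j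
      = a j * (a ⬝ᵥ y) + c * y j := by
    intro j
    simp [add_mulVec, vecMulVec_mulVec, smul_mulVec, mul_comm]
  have hdot : ∑ j, a j * y j = a ⬝ᵥ y := rfl
  calc _ = ∑ j, (a j ^ 2 * (a ⬝ᵥ y) ^ 2 + 2 * c * (a ⬝ᵥ y) * (a j * y j) + c ^ 2 * y j ^ 2) :=
        Finset.sum_congr rfl fun j _ => by rw [hentry]; ring
    _ = _ := by
        rw [Finset.sum_add_distrib, Finset.sum_add_distrib, ← Finset.sum_mul, ← Finset.mul_sum,
          ← Finset.mul_sum, hdot]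
        ring

/-- The quadratic form of `AᵀA + c I` as a sum of squares. -/
theorem dotProduct_transpose_mul_self_add_smul_one_mulVec {n d : ℕ}
    (A : Matrix (Fin n) (Fin d) ℝ) (c : ℝ) (y : Fin d → ℝ) :
    y ⬝ᵥ (Aᵀ * A + c • (1 : Matrix (Fin d) (Fin d) ℝ)).mulVec y
      = ∑ i, (A i ⬝ᵥ y) ^ 2 + c * ∑ j, y j ^ 2 := by
  have hgram : y ⬝ᵥ (Aᵀ * A).mulVec y = ∑ i, (A i ⬝ᵥ y) ^ 2 := by
    rw [← mulVec_mulVec, dotProduct_mulVec, vecMul_transpose]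
    exact Finset.sum_congr rfl fun i _ => (sq _).symm
  have hself : y ⬝ᵥ y = ∑ j, y j ^ 2 := Finset.sum_congr rfl fun j _ => (sq _).symm
  rw [add_mulVec, dotProduct_add, hgram, smul_mulVec, one_mulVec, dotProduct_smul, hself,
    smul_eq_mul]

/-- the SVRG variance bound for ridge regression. For a matrix `A` with
nonzero rows `aᵢ` and `λ > 0`, for every `y`,
`∑ᵢ (‖A‖_F²/‖aᵢ‖²)·‖(aᵢaᵢᵀ + (λ‖aᵢ‖²/‖A‖_F²)I)y‖² ≤ (‖A‖_F² + 2λ)·yᵀ(AᵀA + λI)y`. -/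
theorem stmt_11 (n d : ℕ) (A : Matrix (Fin n) (Fin d) ℝ)
    (hrows : ∀ i, A i ≠ 0) (lam : ℝ) (hlam : 0 < lam) (y : Fin d → ℝ) :
    ∑ i, (∑ i', ∑ j, (A i' j) ^ 2) / (∑ j, (A i j) ^ 2) *
        ∑ j, ((Matrix.vecMulVec (A i) (A i)
            + (lam * (∑ j', (A i j') ^ 2) / (∑ i', ∑ j', (A i' j') ^ 2))
              • (1 : Matrix (Fin d) (Fin d) ℝ)).mulVec y j) ^ 2
      ≤ ((∑ i', ∑ j, (A i' j) ^ 2) + 2 * lam)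
          * (y ⬝ᵥ (Aᵀ * A + lam • (1 : Matrix (Fin d) (Fin d) ℝ)).mulVec y) := by
  have hrow : ∀ i, 0 < ∑ j, A i j ^ 2 := by
    intro i
    obtain ⟨j, hj⟩ := Function.ne_iff.mp (hrows i)
    exact Finset.sum_pos' (fun _ _ => sq_nonneg _) ⟨j, Finset.mem_univ j, sq_pos_of_ne_zero hj⟩
  simp only [sum_sq_vecMulVec_add_smul_one_mulVec,
    dotProduct_transpose_mul_self_add_smul_one_mulVec]
  have hFrow : ∀ i, ∑ j, A i j ^ 2 ≤ ∑ i', ∑ j, A i' j ^ 2 := fun i =>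
    Finset.single_le_sum (f := fun i => ∑ j, A i j ^ 2) (fun i _ => (hrow i).le)
      (Finset.mem_univ i)
  have hF0 : 0 ≤ ∑ i', ∑ j, A i' j ^ 2 := Finset.sum_nonneg fun i _ => (hrow i).le
  have hY : 0 ≤ ∑ j, y j ^ 2 := Finset.sum_nonneg fun j _ => sq_nonneg _
  have hratio : ∑ i, (∑ j, A i j ^ 2) / (∑ i', ∑ j, A i' j ^ 2) ≤ 1 := by
    rw [← Finset.sum_div]
    exact div_self_le_one _
  set F := ∑ i', ∑ j, A i' j ^ 2
  set Y := ∑ j, y j ^ 2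
  calc _ = ∑ i, ((F + 2 * lam) * (A i ⬝ᵥ y) ^ 2 + lam ^ 2 * Y * ((∑ j, A i j ^ 2) / F)) := by
        refine Finset.sum_congr rfl fun i _ => ?_
        have hr := (hrow i).ne'
        have hF : F ≠ 0 := ((hrow i).trans_le (hFrow i)).ne'
        field_simp
    _ = (F + 2 * lam) * ∑ i, (A i ⬝ᵥ y) ^ 2 + lam ^ 2 * Y * ∑ i, (∑ j, A i j ^ 2) / F := by
        rw [Finset.sum_add_distrib, ← Finset.mul_sum, ← Finset.mul_sum]
    _ ≤ (F + 2 * lam) * ∑ i, (A i ⬝ᵥ y) ^ 2 + lam ^ 2 * Y :=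
        add_le_add_right (mul_le_of_le_one_right (by positivity) hratio) _
    _ ≤ (F + 2 * lam) * (∑ i, (A i ⬝ᵥ y) ^ 2 + lam * Y) := by
        have h : 0 ≤ (F + lam) * (lam * Y) := by positivity
        linarith
end

section
/- Let p ∈ (0,2], let n ≥ 1, let σ_1 ≥ σ_2 ≥ … ≥ σ_n ≥ 0 be nonincreasing nonnegative reals, and let k ∈ {1, …, n}. Then k·σ_k² + Σ_{i=k+1}^n σ_i² ≤ k^{1 - 2/p} · ( Σ_{i=1}^n σ_i^p )^{2/p}. -/
/-- the deflated average condition number bound. For `p ∈ (0,2]` and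
nonincreasing nonnegative `σ₁ ≥ … ≥ σₙ ≥ 0` and `k ∈ {1,…,n}`,
`k·σ_k² + ∑_{i=k+1}^n σᵢ² ≤ k^{1-2/p}·(∑_{i=1}^n σᵢ^p)^{2/p}`. -/
theorem stmt_14 (p : ℝ) (hp : p ∈ Set.Ioc (0 : ℝ) 2) (n : ℕ) (hn : 1 ≤ n)
    (σ : ℕ → ℝ) (hnn : ∀ i ∈ Finset.Icc 1 n, 0 ≤ σ i)
    (hmono : ∀ i ∈ Finset.Icc 1 n, ∀ j ∈ Finset.Icc 1 n, i ≤ j → σ j ≤ σ i)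
    (k : ℕ) (hk : k ∈ Finset.Icc 1 n) :
    (k : ℝ) * σ k ^ 2 + ∑ i ∈ Finset.Icc (k + 1) n, σ i ^ 2
      ≤ (k : ℝ) ^ (1 - 2 / p) * (∑ i ∈ Finset.Icc 1 n, σ i ^ p) ^ (2 / p) := by
  obtain ⟨hp0, hp2⟩ := hp
  have hk' := Finset.mem_Icc.mp hk
  have hkpos : (0 : ℝ) < k := by exact_mod_cast hk'.1
  have hr : 0 ≤ 2 / p - 1 := by
    rw [sub_nonneg, le_div_iff₀ hp0]
    linarith
  have hσk := hnn k hk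
  have hsq : ∀ x : ℝ, 0 ≤ x → x ^ 2 = x ^ (2 - p) * x ^ p := fun x hx => by
    rw [← Real.rpow_add_of_nonneg hx (by linarith) hp0.le, sub_add_cancel, Real.rpow_two]
  set S := ∑ i ∈ Finset.Icc 1 n, σ i ^ p with hS
  have hS0 : 0 ≤ S := Finset.sum_nonneg fun i hi => Real.rpow_nonneg (hnn i hi) _
  have htail : ∀ i ∈ Finset.Icc (k + 1) n, i ∈ Finset.Icc 1 n ∧ k ≤ i := fun i hi => by
    simp only [Finset.mem_Icc] at hi ⊢
    omega
  have hsplit : S = ∑ i ∈ Finset.Icc 1 k, σ i ^ p + ∑ i ∈ Finset.Icc (k + 1) n, σ i ^ p := by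
    rw [hS, ← Finset.sum_union]
    · congr 1
      ext i
      simp only [Finset.mem_union, Finset.mem_Icc]
      omega
    · rw [Finset.disjoint_left]
      intro i
      simp only [Finset.mem_Icc]
      omega
  have hhead : (k : ℝ) * σ k ^ p ≤ ∑ i ∈ Finset.Icc 1 k, σ i ^ p := by
    have h := Finset.card_nsmul_le_sum (Finset.Icc 1 k) (fun i => σ i ^ p) (σ k ^ p)
      fun i hi => by
        have hi' := Finset.mem_Icc.mp hi
        exact Real.rpow_le_rpow hσk
          (hmono i (Finset.mem_Icc.mpr ⟨hi'.1, hi'.2.trans hk'.2⟩) k hk hi'.2) hp0.le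
    simpa using h
  have htail0 : 0 ≤ ∑ i ∈ Finset.Icc (k + 1) n, σ i ^ p :=
    Finset.sum_nonneg fun i hi => Real.rpow_nonneg (hnn i (htail i hi).1) _
  have hpow : σ k ^ (2 - p) ≤ (S / k) ^ (2 / p - 1) := by
    have h : σ k ^ (2 - p) = (σ k ^ p) ^ (2 / p - 1) := by
      rw [← Real.rpow_mul hσk]
      congr 1
      field_simp
    rw [h]
    refine Real.rpow_le_rpow (Real.rpow_nonneg hσk _) ?_ hr
    rw [le_div_iff₀ hkpos]
    linarith
  calc (k : ℝ) * σ k ^ 2 + ∑ i ∈ Finset.Icc (k + 1) n, σ i ^ 2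
      ≤ k * (σ k ^ (2 - p) * σ k ^ p)
          + ∑ i ∈ Finset.Icc (k + 1) n, σ k ^ (2 - p) * σ i ^ p := by
        rw [hsq _ hσk]
        gcongr with i hi
        obtain ⟨hi1, hki⟩ := htail i hi
        have hσi := hnn i hi1
        rw [hsq _ hσi]
        exact mul_le_mul_of_nonneg_right
          (Real.rpow_le_rpow hσi (hmono k hk i hi1 hki) (by linarith)) (Real.rpow_nonneg hσi _)
    _ = σ k ^ (2 - p) * (k * σ k ^ p + ∑ i ∈ Finset.Icc (k + 1) n, σ i ^ p) := by
        rw [← Finset.mul_sum]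
        ring
    _ ≤ σ k ^ (2 - p) * S := by
        gcongr
        linarith
    _ ≤ (S / k) ^ (2 / p - 1) * S := by gcongr
    _ = (k : ℝ) ^ (1 - 2 / p) * S ^ (2 / p) := by
        have h : S ^ (2 / p) = S ^ (2 / p - 1) * S := by
          conv_rhs => rw [← Real.rpow_one S, ← Real.rpow_mul hS0, one_mul]
          rw [← Real.rpow_add_of_nonneg hS0 hr zero_le_one, sub_add_cancel]
        rw [h, Real.div_rpow hS0 hkpos.le, ← neg_sub (2 / p) 1, Real.rpow_neg hkpos.le]
        ring
end

section
/- Let p > 0, let g : (0,∞) → (0,∞) satisfy g(y)/g(x) ≥ (y/x)^p for all 0 < x ≤ y, let ε ∈ (0,1), let n ≥ 1, and let σ_1, …, σ_n > 0. Set λ = ( (ε/(2n)) · Σ_{i=1}^n σ_i^p )^{1/p}. Then Σ_{i : σ_i < λ} g(σ_i) ≤ ε · Σ_{i : σ_i ≥ λ} g(σ_i); in particular, Σ_{i : σ_i < λ} g(σ_i) ≤ ε · Σ_{i=1}^n g(σ_i). -/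
open scoped Classical

/-- the small-tail lemma. If `g` grows at least like a `p`-th power on
`(0,∞)` and `λ = ((ε/(2n))·∑σᵢ^p)^{1/p}`, then the values `σᵢ < λ` contribute at most an
`ε` fraction of the spectral sum of `g`. -/
theorem stmt_16 (p : ℝ) (hp : 0 < p) (g : ℝ → ℝ)
    (hgpos : ∀ x : ℝ, 0 < x → 0 < g x)
    (hgrow : ∀ x y : ℝ, 0 < x → x ≤ y → (y / x) ^ p ≤ g y / g x)
    (ε : ℝ) (hε : ε ∈ Set.Ioo (0 : ℝ) 1) (n : ℕ) (hn : 1 ≤ n)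
    (σ : Fin n → ℝ) (hσ : ∀ i, 0 < σ i)
    (lam : ℝ) (hlam : lam = (ε / (2 * n) * ∑ i, σ i ^ p) ^ (1 / p)) :
    (∑ i ∈ Finset.univ.filter fun i => σ i < lam, g (σ i))
        ≤ ε * ∑ i ∈ Finset.univ.filter fun i => lam ≤ σ i, g (σ i) ∧
    (∑ i ∈ Finset.univ.filter fun i => σ i < lam, g (σ i)) ≤ ε * ∑ i, g (σ i) := by
  obtain ⟨hε0, hε1⟩ := hε
  have hn0 : (0 : ℝ) < n := by exact_mod_cast hn
  have hS : 0 < ∑ i, σ i ^ p :=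
    Finset.sum_pos (fun i _ => Real.rpow_pos_of_pos (hσ i) p) ⟨⟨0, hn⟩, Finset.mem_univ _⟩
  have hL : 0 < ε / (2 * n) * ∑ i, σ i ^ p := by positivity
  have hlam0 : 0 < lam := hlam ▸ Real.rpow_pos_of_pos hL _
  have hlamp : lam ^ p = ε / (2 * n) * ∑ i, σ i ^ p := by
    rw [hlam, ← Real.rpow_mul hL.le, one_div_mul_cancel hp.ne', Real.rpow_one]
  have hlamp0 : 0 < lam ^ p := hlamp ▸ hL
  have hεS : ε * ∑ i, σ i ^ p = 2 * (n * lam ^ p) := by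
    rw [hlamp]; field_simp
  have hg := hgpos lam hlam0
  have split (f : Fin n → ℝ) : ∑ i, f i = (∑ i ∈ Finset.univ.filter fun i => σ i < lam, f i) +
      ∑ i ∈ Finset.univ.filter fun i => lam ≤ σ i, f i := by
    simpa only [not_lt] using
      (Finset.sum_filter_add_sum_filter_not Finset.univ (fun i => σ i < lam) f).symm
  have sum_small_le {f : Fin n → ℝ} {c : ℝ} (hc : 0 ≤ c) (hf : ∀ i, σ i < lam → f i ≤ c) :
      (∑ i ∈ Finset.univ.filter fun i => σ i < lam, f i) ≤ n * c := by
    refine (Finset.sum_le_card_nsmul _ _ c fun i hi => hf i (Finset.mem_filter.1 hi).2).trans ?_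
    rw [nsmul_eq_mul]
    gcongr
    simpa using Finset.card_filter_le (Finset.univ : Finset (Fin n)) fun i => σ i < lam
  have small_pow : (∑ i ∈ Finset.univ.filter fun i => σ i < lam, σ i ^ p) ≤ n * lam ^ p :=
    sum_small_le hlamp0.le fun i hi => Real.rpow_le_rpow (hσ i).le hi.le hp.le
  have small_g : (∑ i ∈ Finset.univ.filter fun i => σ i < lam, g (σ i)) ≤ n * g lam := by
    refine sum_small_le hg.le fun i hi => ?_
    have h := hgrow (σ i) lam (hσ i) hi.le
    have h1 : 1 ≤ (lam / σ i) ^ p :=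
      Real.one_le_rpow ((one_le_div (hσ i)).2 hi.le) hp.le
    exact (one_le_div (hgpos _ (hσ i))).1 (h1.trans h)
  have big_g : g lam * (∑ i ∈ Finset.univ.filter fun i => lam ≤ σ i, σ i ^ p) ≤
      lam ^ p * ∑ i ∈ Finset.univ.filter fun i => lam ≤ σ i, g (σ i) := by
    rw [Finset.mul_sum, Finset.mul_sum]
    refine Finset.sum_le_sum fun i hi => ?_
    have h := hgrow lam (σ i) hlam0 (Finset.mem_filter.1 hi).2
    rw [Real.div_rpow (hσ i).le hlam0.le, div_le_div_iff₀ hlamp0 hg] at h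
    linarith
  have big_pow : n * lam ^ p ≤
      ε * ∑ i ∈ Finset.univ.filter fun i => lam ≤ σ i, σ i ^ p := by
    have h := mul_le_mul_of_nonneg_left small_pow hε0.le
    have h1 : ε * (n * lam ^ p) ≤ n * lam ^ p := mul_le_of_le_one_left (by positivity) hε1.le
    rw [split fun i => σ i ^ p, mul_add] at hεS
    linarith
  have main : (∑ i ∈ Finset.univ.filter fun i => σ i < lam, g (σ i))
      ≤ ε * ∑ i ∈ Finset.univ.filter fun i => lam ≤ σ i, g (σ i) := by
    refine small_g.trans (le_of_mul_le_mul_left ?_ hlamp0)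
    have h := mul_le_mul_of_nonneg_left big_g hε0.le
    have h1 := mul_le_mul_of_nonneg_left big_pow hg.le
    linarith
  refine ⟨main, main.trans (mul_le_mul_of_nonneg_left ?_ hε0.le)⟩
  rw [split fun i => g (σ i)]
  exact le_add_of_nonneg_left (Finset.sum_nonneg fun i _ => (hgpos _ (hσ i)).le)
end

section
/- Let α ∈ (0,1), γ ∈ (0, α/2], ε ∈ (0,1], c₁ ≥ 1, and f : (0,∞) → [0,∞). Let a₁ ∈ [1-α, 1], set a₀ = 1 and a_t = a₁(1-α)^{t-1} for t ≥ 1. Let μ_1, …, μ_d ∈ (0,1]. For each t ∈ ℕ, let h_t : ℝ → ℝ be a γ-soft window for [a_{t+1}, a_t] (h_t(x) ∈ [0,1] for x ∈ [0,1], h_t(x) = 1 for x ∈ [a_{t+1}, a_t], h_t(x) = 0 for x ∉ [(1-γ)a_{t+1}, (1+γ)a_t]), and let q_t : ℝ → ℝ satisfy: q_t(0) = 0; q_t(y) ≤ c₁·q_t(x) whenever 0 ≤ y ≤ x; and |q_t(x) - f(x)| ≤ ε·f(x) for all x ∈ [(1-γ)a_{t+1}, (1+γ)a_t]. Then for every T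 ≥ 1, Σ_{t=T+1}^∞ Σ_{i=1}^d q_t( μ_i · h_t(μ_i) ) ≤ 4·c₁ · Σ_{i : μ_i ≤ a_T} f(μ_i). -/
open scoped Classical

/-- A real sequence bounded above by `B` whose nonzero indices lie within distance one of each other
is summable, with sum at most `2 * B`. -/
theorem summable_and_tsum_le_two_mul (g : ℕ → ℝ) (B : ℝ) (hg : ∀ t, g t ≤ B)
    (hsupp : ∀ t s, g t ≠ 0 → g s ≠ 0 → s ≤ t + 1) :
    Summable g ∧ ∑' t, g t ≤ 2 * B := by
  obtain ⟨t₀, ht₀⟩ : ∃ t₀, ∀ t ∉ ({t₀, t₀ + 1} : Finset ℕ), g t = 0 := by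
    by_cases hex : ∃ t, g t ≠ 0
    · refine ⟨Nat.find hex, fun t ht => ?_⟩
      by_contra hne
      have hle := Nat.find_min' hex hne
      have hge := hsupp _ t (Nat.find_spec hex) hne
      simp only [Finset.mem_insert, Finset.mem_singleton, not_or] at ht
      omega
    · push Not at hex
      exact ⟨0, fun t _ => hex t⟩
  refine ⟨summable_of_ne_finset_zero ht₀, ?_⟩
  rw [tsum_eq_sum ht₀, Finset.sum_pair (by omega)]
  linarith [hg t₀, hg (t₀ + 1)]

/-- the truncated windowed spectral sum tail bound. With geometric grid
`a₀ = 1`, `a_t = a₁(1-α)^{t-1}`, γ-soft windows `h_t` for `[a_{t+1}, a_t]`, and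
well-behaved approximations `q_t` of `f` on each window support, the tail of the
windowed sum past level `T` is at most `4c₁·∑_{i : μᵢ ≤ a_T} f(μᵢ)`. -/
theorem stmt_18 (α γ ε c₁ : ℝ) (hα : α ∈ Set.Ioo (0 : ℝ) 1) (hγ : 0 < γ)
    (hγ2 : γ ≤ α / 2) (hε : ε ∈ Set.Ioc (0 : ℝ) 1) (hc : 1 ≤ c₁)
    (f : ℝ → ℝ) (hf : ∀ x : ℝ, 0 < x → 0 ≤ f x)
    (a₁ : ℝ) (ha₁ : a₁ ∈ Set.Icc (1 - α) 1)
    (a : ℕ → ℝ) (ha0 : a 0 = 1) (hat : ∀ t : ℕ, 1 ≤ t → a t = a₁ * (1 - α) ^ (t - 1))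
    (d : ℕ) (μ : Fin d → ℝ) (hμ : ∀ i, μ i ∈ Set.Ioc (0 : ℝ) 1)
    (h q : ℕ → ℝ → ℝ)
    (hwin1 : ∀ t : ℕ, ∀ x ∈ Set.Icc (0 : ℝ) 1, h t x ∈ Set.Icc (0 : ℝ) 1)
    (hwin2 : ∀ t : ℕ, ∀ x ∈ Set.Icc (a (t + 1)) (a t), h t x = 1)
    (hwin3 : ∀ t : ℕ, ∀ x : ℝ, x ∉ Set.Icc ((1 - γ) * a (t + 1)) ((1 + γ) * a t) →
      h t x = 0)
    (hq0 : ∀ t : ℕ, q t 0 = 0)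
    (hqmono : ∀ t : ℕ, ∀ x y : ℝ, 0 ≤ y → y ≤ x → q t y ≤ c₁ * q t x)
    (hqapprox : ∀ t : ℕ, ∀ x ∈ Set.Icc ((1 - γ) * a (t + 1)) ((1 + γ) * a t),
      |q t x - f x| ≤ ε * f x)
    (T : ℕ) (hT : 1 ≤ T) :
    (∑' t : ℕ, if T + 1 ≤ t then ∑ i, q t (μ i * h t (μ i)) else 0)
      ≤ 4 * c₁ * ∑ i ∈ Finset.univ.filter fun i => μ i ≤ a T, f (μ i) := by
  obtain ⟨hα0, hα1⟩ := hα
  have ha1pos : 0 < a₁ := by linarith [ha₁.1]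
  have hapos : ∀ t, 1 ≤ t → 0 < a t := fun t ht => by
    rw [hat t ht]
    have : 0 < 1 - α := by linarith
    positivity
  have hgap : ∀ m s, 1 ≤ m → m < s → (1 + γ) * a s < (1 - γ) * a m := by
    intro m s hm hms
    have hle : a s ≤ (1 - α) * a m := by
      rw [hat s (by omega), hat m hm]
      have hpow : (1 - α) ^ (s - 1) ≤ (1 - α) ^ (m - 1 + 1) :=
        pow_le_pow_of_le_one (by linarith) (by linarith) (by omega)
      calc a₁ * (1 - α) ^ (s - 1) ≤ a₁ * (1 - α) ^ (m - 1 + 1) := by gcongr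
        _ = (1 - α) * (a₁ * (1 - α) ^ (m - 1)) := by ring
    have hratio : (1 + γ) * (1 - α) < 1 - γ := by nlinarith [mul_pos hα0 hγ]
    calc (1 + γ) * a s ≤ (1 + γ) * ((1 - α) * a m) := by gcongr
      _ = (1 + γ) * (1 - α) * a m := by ring
      _ < (1 - γ) * a m := mul_lt_mul_of_pos_right hratio (hapos m hm)
  set g : Fin d → ℕ → ℝ := fun i t => if T + 1 ≤ t then q t (μ i * h t (μ i)) else 0 with hg
  have hmem : ∀ i t, g i t ≠ 0 →
      T + 1 ≤ t ∧ μ i ∈ Set.Icc ((1 - γ) * a (t + 1)) ((1 + γ) * a t) := by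
    intro i t hne
    by_cases ht : T + 1 ≤ t
    · refine ⟨ht, ?_⟩
      by_contra hout
      exact hne (by simp [hg, hwin3 t _ hout, hq0])
    · exact absurd (by simp only [hg, if_neg ht]) hne
  have hfμ : ∀ i, 0 ≤ f (μ i) := fun i => hf _ (hμ i).1
  have hbound : ∀ i t, g i t ≤ 2 * c₁ * f (μ i) := by
    intro i t
    by_cases hne : g i t = 0
    · rw [hne]
      have := hfμ i
      positivity
    obtain ⟨ht, hin⟩ := hmem i t hne
    obtain ⟨hh0, hh1⟩ := hwin1 t (μ i) ⟨(hμ i).1.le, (hμ i).2⟩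
    have hq := hqmono t (μ i) (μ i * h t (μ i)) (mul_nonneg (hμ i).1.le hh0)
      (mul_le_of_le_one_right (hμ i).1.le hh1)
    have happ := (abs_le.mp (hqapprox t _ hin)).2
    have hq2 : q t (μ i) ≤ 2 * f (μ i) := by
      linarith [mul_le_of_le_one_left (hfμ i) hε.2]
    calc g i t = q t (μ i * h t (μ i)) := by simp only [hg, if_pos ht]
      _ ≤ c₁ * q t (μ i) := hq
      _ ≤ c₁ * (2 * f (μ i)) := by gcongr
      _ = 2 * c₁ * f (μ i) := by ring
  have hsum : ∀ i, Summable (g i) ∧ ∑' t, g i t ≤ 2 * (2 * c₁ * f (μ i)) := by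
    intro i
    refine summable_and_tsum_le_two_mul _ _ (hbound i) fun t s ht hs => ?_
    by_contra! hlt
    exact absurd (hgap (t + 1) s (by omega) hlt)
      (not_lt.mpr ((hmem i t ht).2.1.trans (hmem i s hs).2.2))
  have hzero : ∀ i, ¬ μ i ≤ a T → ∑' t, g i t = 0 := by
    intro i hi
    have hvanish : ∀ t, g i t = 0 := by
      intro t
      by_contra hne
      obtain ⟨ht, -, hupper⟩ := hmem i t hne
      nlinarith [hgap T t hT ht, mul_pos hγ (hapos T hT)]
    simp [hvanish]
  calc (∑' t : ℕ, if T + 1 ≤ t then ∑ i, q t (μ i * h t (μ i)) else 0)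
      = ∑' t, ∑ i, g i t := by
        refine tsum_congr fun t => ?_
        by_cases ht : T + 1 ≤ t <;> simp only [hg, ht, if_true, if_false, Finset.sum_const_zero]
    _ = ∑ i, ∑' t, g i t := Summable.tsum_finsetSum fun i _ => (hsum i).1
    _ ≤ ∑ i, if μ i ≤ a T then 4 * c₁ * f (μ i) else 0 := by
        refine Finset.sum_le_sum fun i _ => ?_
        split_ifs with hi
        · linarith [(hsum i).2]
        · exact (hzero i hi).le
    _ = 4 * c₁ * ∑ i ∈ Finset.univ.filter fun i => μ i ≤ a T, f (μ i) := by
        rw [← Finset.sum_filter, Finset.mul_sum]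
end

section
/- Let α ∈ (0,1), γ ∈ (0, α/2], ε ∈ (0,1], c₁ ≥ 1, let f : (0,∞) → [0,∞), and let μ_1, …, μ_d ∈ (0,1] (the eigenvalues of a positive definite matrix with operator norm at most 1). Then there is a measurable set Good ⊆ [1-α, 1] of Lebesgue measure at least (9/10)·α such that for every a₁ ∈ Good the following holds. Set a₀ = 1 and a_t = a₁(1-α)^{t-1} for t ≥ 1. For every family of functions (h_t)_{t∈ℕ} and (q_t)_{t∈ℕ} such that each h_t : ℝ → ℝ is a γ-soft window for [a_{t+1}, a_t] (h_t(x) ∈ [0,1] for x ∈ [0,1], h_t = 1 on [a_{t+1}, a_t], h_t = 0 off [(1-γ)a_{t+1}, (1+γ)a_t]) and each q_t : ℝ → ℝ satisfies q_t(0) = 0, q_t(y) ≤ c₁·q_t(x) whenever 0 ≤ y ≤ x, and |q_t(x) - f(x)| ≤ ε·f(x) for all x ∈ [(1-γ)a_{t+1}, (1+γ)a_t], one has (1 - ε - 320·c₁·γ/α) · Σ_{i=1}^d f(μ_i) ≤ Σ_{t=0}^∞ Σ_{i=1}^d q_t( μ_i · h_t(μ_i) ) ≤ (1 + ε + 320·c₁·γ/α)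 · Σ_{i=1}^d f(μ_i). In other words, if the grid shift a₁ is chosen uniformly at random from [1-α,1], then with probability at least 9/10 the windowed spectral sum approximates Σ_i f(μ_i) up to relative error ε + 320·c₁·γ/α. -/
open MeasureTheory in
/-- Weighted Markov inequality: if each of finitely many events has measure at most `m`, then the
total weight of the events that occur exceeds `c` times the total weight with measure at most
`m / c`. -/
lemma measure_mul_sum_lt_sum_indicator_le {Ω ι : Type*} [MeasurableSpace Ω] [Fintype ι]
    (ν : Measure Ω) (B : ι → Set Ω) (hB : ∀ i, MeasurableSet (B i)) (w : ι → ℝ)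
    (hw : ∀ i, 0 ≤ w i) {m c : ℝ} (hc : 0 < c) (hνB : ∀ i, ν (B i) ≤ ENNReal.ofReal m) :
    ν {x | c * ∑ i, w i < ∑ i, (B i).indicator (fun _ => w i) x} ≤ ENNReal.ofReal (m / c) := by
  have hW : 0 ≤ ∑ i, w i := Finset.sum_nonneg fun i _ => hw i
  rcases hW.eq_or_lt with hW0 | hWpos
  · have hempty : {x | c * ∑ i, w i < ∑ i, (B i).indicator (fun _ => w i) x} = ∅ := by
      refine Set.eq_empty_iff_forall_notMem.2 fun x hx => ?_
      have hle : ∑ i, (B i).indicator (fun _ => w i) x ≤ ∑ i, w i :=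
        Finset.sum_le_sum fun i _ => Set.indicator_le_self' (fun _ _ => hw i) x
      rw [Set.mem_ofPred_eq, ← hW0] at hx
      linarith
    simp [hempty]
  have hcW : 0 < c * ∑ i, w i := mul_pos hc hWpos
  have hint : ∫⁻ x, ENNReal.ofReal (∑ i, (B i).indicator (fun _ => w i) x) ∂ν
      ≤ ENNReal.ofReal (∑ i, w i) * ENNReal.ofReal m := by
    have hpt : ∀ x, ENNReal.ofReal (∑ i, (B i).indicator (fun _ => w i) x)
        = ∑ i, (B i).indicator (fun _ => ENNReal.ofReal (w i)) x := by
      intro x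
      rw [ENNReal.ofReal_sum_of_nonneg fun i _ => Set.indicator_nonneg (fun _ _ => hw i) x]
      refine Finset.sum_congr rfl fun i _ => ?_
      by_cases hx : x ∈ B i <;> simp [hx]
    simp_rw [hpt]
    rw [lintegral_finsetSum _ fun i _ => measurable_const.indicator (hB i),
      ENNReal.ofReal_sum_of_nonneg fun i _ => hw i, Finset.sum_mul]
    refine Finset.sum_le_sum fun i _ => ?_
    rw [lintegral_indicator_const (hB i)]
    gcongr
    exact hνB i
  have hmeas : Measurable fun x => ENNReal.ofReal (∑ i, (B i).indicator (fun _ => w i) x) :=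
    (Finset.measurable_fun_sum _ fun i _ => measurable_const.indicator (hB i)).ennreal_ofReal
  calc ν {x | c * ∑ i, w i < ∑ i, (B i).indicator (fun _ => w i) x}
      ≤ ν {x | ENNReal.ofReal (c * ∑ i, w i)
          ≤ ENNReal.ofReal (∑ i, (B i).indicator (fun _ => w i) x)} :=
        measure_mono fun x hx => ENNReal.ofReal_le_ofReal (le_of_lt hx)
    _ ≤ (∫⁻ x, ENNReal.ofReal (∑ i, (B i).indicator (fun _ => w i) x) ∂ν)
          / ENNReal.ofReal (c * ∑ i, w i) :=
        meas_ge_le_lintegral_div hmeas.aemeasurable (by simpa using hcW) ENNReal.ofReal_ne_top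
    _ ≤ (ENNReal.ofReal (∑ i, w i) * ENNReal.ofReal m) / ENNReal.ofReal (c * ∑ i, w i) := by
        gcongr
    _ = ENNReal.ofReal (m / c) := by
        rw [← ENNReal.ofReal_mul hW, ← ENNReal.ofReal_div_of_pos hcW]
        congr 1
        field_simp

/-- The shifts in `[1-α, 1]` for which `x` is within relative distance `γ` of a grid point. -/
def badShifts (α γ x : ℝ) : Set ℝ :=
  ⋃ n : ℕ, Set.Icc (1 - α) 1 ∩
    {s | (1 - γ) * (s * (1 - α) ^ n) ≤ x ∧ x ≤ (1 + γ) * (s * (1 - α) ^ n)}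

lemma measurableSet_badShifts (α γ x : ℝ) : MeasurableSet (badShifts α γ x) := by
  refine MeasurableSet.iUnion fun n => measurableSet_Icc.inter ?_
  have hg : Measurable fun s : ℝ => s * (1 - α) ^ n := by fun_prop
  exact (measurableSet_le (hg.const_mul (1 - γ)) measurable_const).inter
    (measurableSet_le measurable_const (hg.const_mul (1 + γ)))

lemma volume_badShifts_piece_le {α γ x : ℝ} (hα : α ∈ Set.Ioo (0 : ℝ) 1) (hγ : 0 < γ)
    (hγ2 : γ ≤ α / 2) (n : ℕ) :
    MeasureTheory.volume (Set.Icc (1 - α) 1 ∩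
      {s | (1 - γ) * (s * (1 - α) ^ n) ≤ x ∧ x ≤ (1 + γ) * (s * (1 - α) ^ n)})
      ≤ ENNReal.ofReal (4 * γ) := by
  obtain ⟨hα0, hα1⟩ := hα
  have hr : 0 < (1 - α) ^ n := pow_pos (by linarith) n
  rcases Set.eq_empty_or_nonempty (Set.Icc (1 - α) 1 ∩
    {s | (1 - γ) * (s * (1 - α) ^ n) ≤ x ∧ x ≤ (1 + γ) * (s * (1 - α) ^ n)}) with h | ⟨s, hs, hs'⟩
  · simp [h]
  set y := x / (1 - α) ^ n with hy
  have hyle : y ≤ 1 + γ := by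
    rw [hy, div_le_iff₀ hr]
    refine hs'.2.trans ?_
    gcongr
    exact mul_le_of_le_one_left hr.le hs.2
  have h1 : 0 < 1 - γ := by linarith
  have hsub : Set.Icc (1 - α) 1 ∩
      {s | (1 - γ) * (s * (1 - α) ^ n) ≤ x ∧ x ≤ (1 + γ) * (s * (1 - α) ^ n)}
      ⊆ Set.Icc (y / (1 + γ)) (y / (1 - γ)) := by
    rintro s ⟨-, hs1, hs2⟩
    constructor
    · rw [hy, div_le_iff₀ (by linarith), div_le_iff₀ hr]
      linarith
    · rw [hy, le_div_iff₀ h1, le_div_iff₀ hr]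
      linarith
  refine (MeasureTheory.measure_mono hsub).trans ?_
  rw [Real.volume_Icc]
  apply ENNReal.ofReal_le_ofReal
  rw [div_sub_div _ _ h1.ne' (by linarith), div_le_iff₀ (by nlinarith)]
  nlinarith [mul_le_mul_of_nonneg_left hyle hγ.le, mul_pos hγ (show 0 < 1 + γ by linarith)]

lemma volume_badShifts_le {α γ x : ℝ} (hα : α ∈ Set.Ioo (0 : ℝ) 1) (hγ : 0 < γ)
    (hγ2 : γ ≤ α / 2) :
    MeasureTheory.volume (badShifts α γ x) ≤ ENNReal.ofReal (8 * γ) := by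
  classical
  have hpiece := volume_badShifts_piece_le (x := x) hα hγ hγ2
  obtain ⟨hα0, hα1⟩ := hα
  unfold badShifts
  set P : ℕ → Set ℝ := fun n => Set.Icc (1 - α) 1 ∩
    {s | (1 - γ) * (s * (1 - α) ^ n) ≤ x ∧ x ≤ (1 + γ) * (s * (1 - α) ^ n)} with hP
  by_cases hne : ∃ n, (P n).Nonempty
  · set n := Nat.find hne
    obtain ⟨s, hs, hs1, -⟩ := Nat.find_spec hne
    have hsub : ⋃ k, P k ⊆ P n ∪ P (n + 1) := by
      refine Set.iUnion_subset fun k b hb => ?_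
      have hnk : n ≤ k := Nat.find_min' hne ⟨b, hb⟩
      by_cases hk : k ≤ n + 1
      · obtain rfl | rfl : k = n ∨ k = n + 1 := by lia
        exacts [Or.inl hb, Or.inr hb]
      exfalso
      have hpow : (1 - α) ^ k ≤ (1 - α) ^ (n + 2) :=
        pow_le_pow_of_le_one (by linarith) (by linarith) (by lia)
      have hr : 0 < (1 - α) ^ (n + 1) := pow_pos (by linarith) _
      have hlow : (1 - γ) * (1 - α) ^ (n + 1) ≤ x := by
        refine le_trans ?_ hs1
        rw [pow_succ']
        have : 0 < (1 - α) ^ n := pow_pos (by linarith) _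
        gcongr
        · linarith
        · exact hs.1
      have hupp : x ≤ (1 + γ) * ((1 - α) * (1 - α) ^ (n + 1)) := by
        refine hb.2.2.trans ?_
        rw [← pow_succ']
        gcongr
        exact (mul_le_of_le_one_left (pow_nonneg (by linarith) _) hb.1.2).trans hpow
      nlinarith [mul_pos hα0 hγ, mul_pos (mul_pos hα0 hγ) hr]
    calc MeasureTheory.volume (⋃ k, P k)
        ≤ MeasureTheory.volume (P n ∪ P (n + 1)) := MeasureTheory.measure_mono hsub
      _ ≤ MeasureTheory.volume (P n) + MeasureTheory.volume (P (n + 1)) :=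
        MeasureTheory.measure_union_le _ _
      _ ≤ ENNReal.ofReal (4 * γ) + ENNReal.ofReal (4 * γ) :=
        add_le_add (hpiece n) (hpiece (n + 1))
      _ = ENNReal.ofReal (8 * γ) := by
        rw [← ENNReal.ofReal_add (by linarith) (by linarith)]
        ring_nf
  · have : ⋃ k, P k = ∅ :=
      Set.iUnion_eq_empty.2 fun k => Set.not_nonempty_iff_eq_empty.1 fun h => hne ⟨k, h⟩
    simp [this]

/-- The windowed terms at a single point `x`, where `F` plays the role of `f x`: they are summable,
their sum is at least `(1 - ε) F`, and it exceeds `(1 + ε) F` by at most `4 c₁ F`, and only if the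
shift is bad for `x`. -/
lemma windowed_tsum_bounds {α γ ε c₁ a₁ x F : ℝ} (hα : α ∈ Set.Ioo (0 : ℝ) 1) (hγ : 0 < γ)
    (hγ2 : γ ≤ α / 2) (hε : ε ∈ Set.Ioc (0 : ℝ) 1) (hc : 1 ≤ c₁) (hx : x ∈ Set.Ioc (0 : ℝ) 1)
    (hF : 0 ≤ F) (ha₁ : a₁ ∈ Set.Icc (1 - α) 1) {a : ℕ → ℝ} (ha0 : a 0 = 1)
    (ha : ∀ t : ℕ, 1 ≤ t → a t = a₁ * (1 - α) ^ (t - 1)) {η : ℕ → ℝ} {q : ℕ → ℝ → ℝ}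
    (hη : ∀ t, η t ∈ Set.Icc (0 : ℝ) 1)
    (hη1 : ∀ t, x ∈ Set.Icc (a (t + 1)) (a t) → η t = 1)
    (hη0 : ∀ t, x ∉ Set.Icc ((1 - γ) * a (t + 1)) ((1 + γ) * a t) → η t = 0)
    (hq0 : ∀ t, q t 0 = 0)
    (hq : ∀ t : ℕ, ∀ x y : ℝ, 0 ≤ y → y ≤ x → q t y ≤ c₁ * q t x)
    (hqF : ∀ t, x ∈ Set.Icc ((1 - γ) * a (t + 1)) ((1 + γ) * a t) → |q t x - F| ≤ ε * F) :
    Summable (fun t => q t (x * η t)) ∧ (1 - ε) * F ≤ ∑' t, q t (x * η t) ∧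
      ∑' t, q t (x * η t)
        ≤ (1 + ε) * F + 4 * c₁ * (badShifts α γ x).indicator (fun _ => F) a₁ := by
  classical
  obtain ⟨hα0, hα1⟩ := hα
  obtain ⟨hε0, hε1⟩ := hε
  obtain ⟨hx0, hx1⟩ := hx
  have hr0 : 0 < 1 - α := by linarith
  have ha₁0 : 0 < a₁ := hr0.trans_le ha₁.1
  have hsucc : ∀ t, a (t + 1) = a₁ * (1 - α) ^ t := fun t => by simpa using ha (t + 1) (by lia)
  have hpos : ∀ t, 0 < a t := by
    rintro (_ | t)
    · simp [ha0]
    · rw [hsucc]; positivity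
  have hstep : ∀ t, a (t + 2) = (1 - α) * a (t + 1) := fun t => by
    rw [hsucc, hsucc, pow_succ]; ring
  have hanti : Antitone a := by
    refine antitone_nat_of_succ_le ?_
    rintro (_ | t)
    · rw [hsucc, ha0]; simpa using ha₁.2
    · rw [hstep]; nlinarith [hpos (t + 1)]
  have hbad : ∀ t, (1 - γ) * a (t + 1) ≤ x → x ≤ (1 + γ) * a (t + 1) → a₁ ∈ badShifts α γ x :=
    fun t h1 h2 => Set.mem_iUnion.2 ⟨t, ha₁, by rwa [← hsucc], by rwa [← hsucc]⟩
  have hex : ∃ t, a (t + 1) ≤ x := by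
    obtain ⟨n, hn⟩ := exists_pow_lt_of_lt_one hx0 (show 1 - α < 1 by linarith)
    exact ⟨n, by rw [hsucc]; nlinarith [ha₁.2, pow_pos hr0 n]⟩
  obtain ⟨k, hk1, hk2⟩ : ∃ k, a (k + 1) ≤ x ∧ x ≤ a k := by
    refine ⟨Nat.find hex, Nat.find_spec hex, ?_⟩
    rcases hk : Nat.find hex with _ | m
    · rwa [ha0]
    · exact (not_le.1 (Nat.find_min hex (by lia : m < Nat.find hex))).le
  have hnonneg : ∀ t, 0 ≤ q t (x * η t) := fun t => by
    have := hq t (x * η t) 0 le_rfl (mul_nonneg hx0.le (hη t).1)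
    rw [hq0] at this
    exact nonneg_of_mul_nonneg_right this (by linarith)
  have hmain : |q k (x * η k) - F| ≤ ε * F := by
    rw [hη1 k ⟨hk1, hk2⟩, mul_one]
    refine hqF k ⟨?_, ?_⟩ <;> nlinarith [hpos k, hpos (k + 1)]
  rw [abs_le] at hmain
  set K := 2 * c₁ * (badShifts α γ x).indicator (fun _ => F) a₁ with hK
  have hK0 : 0 ≤ K :=
    mul_nonneg (by linarith) (Set.indicator_nonneg (fun _ _ => hF) _)
  have hside : ∀ t, a₁ ∈ badShifts α γ x →
      x ∈ Set.Icc ((1 - γ) * a (t + 1)) ((1 + γ) * a t) → q t (x * η t) ≤ K := by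
    intro t hb hxt
    have h1 := hq t x (x * η t) (mul_nonneg hx0.le (hη t).1) (mul_le_of_le_one_right hx0.le (hη t).2)
    have h2 := (abs_le.1 (hqF t hxt)).2
    rw [hK, Set.indicator_of_mem hb]
    nlinarith [mul_nonneg (show 0 ≤ 1 - ε by linarith) hF]
  have hzero : ∀ t, t ≠ k → t ≠ k + 1 → t ≠ k - 1 → q t (x * η t) = 0 := by
    intro t h1 h2 h3
    rw [hη0 t, mul_zero, hq0]
    rintro ⟨hl, hu⟩
    rcases lt_or_gt_of_ne h1 with h | h
    · have h4 := hanti (show t + 2 ≤ k by lia)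
      rw [hstep] at h4
      nlinarith [hpos (t + 1)]
    · have h4 := hanti (show k + 2 ≤ t by lia)
      rw [hstep] at h4
      have h5 : x ≤ (1 + γ) * ((1 - α) * x) := hu.trans (by gcongr; exact h4.trans (by gcongr))
      nlinarith [mul_pos hα0 hγ, mul_pos (mul_pos hα0 hγ) hx0, mul_pos hα0 hx0]
  have hle : ∀ t, q t (x * η t) ≤ (if t = k then (1 + ε) * F else 0)
      + (if t = k + 1 then K else 0) + (if t = k - 1 then K else 0) := by
    intro t
    have hite : ∀ (p : Prop) [Decidable p], 0 ≤ if p then K else 0 := fun p _ => by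
      split_ifs <;> simp [hK0]
    by_cases h1 : t = k
    · have := hite (t = k + 1)
      have := hite (t = k - 1)
      rw [if_pos h1]
      subst h1
      linarith
    rw [if_neg h1, zero_add]
    by_cases hxt : x ∈ Set.Icc ((1 - γ) * a (t + 1)) ((1 + γ) * a t)
    swap
    · rw [hη0 t hxt, mul_zero, hq0]
      exact add_nonneg (hite _) (hite _)
    by_cases h2 : t = k + 1
    · have := hite (t = k - 1)
      rw [if_pos h2]
      have hb : a₁ ∈ badShifts α γ x := by
        refine hbad k ?_ (h2 ▸ hxt.2)
        nlinarith [hpos (k + 1)]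
      linarith [hside t hb hxt]
    by_cases h3 : t = k - 1
    · rw [if_neg h2, if_pos h3, zero_add]
      have hb : a₁ ∈ badShifts α γ x := by
        refine hbad t hxt.1 ?_
        rw [show t + 1 = k by lia]
        nlinarith [hpos k]
      exact hside t hb hxt
    rw [hzero t h1 h2 h3]
    exact add_nonneg (hite _) (hite _)
  have hsupp : ∀ t ∉ Finset.range (k + 2), q t (x * η t) = 0 := fun t ht => by
    rw [Finset.mem_range] at ht
    exact hzero t (by lia) (by lia) (by lia)
  have hsum : Summable fun t => q t (x * η t) := summable_of_ne_finset_zero hsupp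
  refine ⟨hsum, ?_, ?_⟩
  · have := hsum.le_tsum k fun t _ => hnonneg t
    linarith
  · rw [tsum_eq_sum hsupp]
    refine (Finset.sum_le_sum fun t _ => hle t).trans ?_
    rw [Finset.sum_add_distrib, Finset.sum_add_distrib, Finset.sum_ite_eq', Finset.sum_ite_eq',
      Finset.sum_ite_eq', if_pos (by simp), if_pos (by simp), if_pos (by simp; lia), hK]
    linarith


/-- the random-shift windowed spectral sum approximation. There is a set
`Good ⊆ [1-α,1]` of measure at least `(9/10)·α` of grid shifts `a₁` such that for any
γ-soft windows `h_t` for the buckets `[a_{t+1}, a_t]` of the geometric grid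
`a_t = a₁(1-α)^{t-1}` and any well-behaved approximations `q_t` of `f` on the window
supports, the windowed spectral sum `∑_t ∑_i q_t(μᵢ·h_t(μᵢ))` approximates
`∑_i f(μᵢ)` up to relative error `ε + 320·c₁·γ/α`. -/
theorem stmt_19 (α γ ε c₁ : ℝ) (hα : α ∈ Set.Ioo (0 : ℝ) 1) (hγ : 0 < γ)
    (hγ2 : γ ≤ α / 2) (hε : ε ∈ Set.Ioc (0 : ℝ) 1) (hc : 1 ≤ c₁)
    (d : ℕ) (μ : Fin d → ℝ) (hμ : ∀ i, μ i ∈ Set.Ioc (0 : ℝ) 1)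
    (f : ℝ → ℝ) (hf : ∀ x : ℝ, 0 < x → 0 ≤ f x) :
    ∃ Good : Set ℝ, MeasurableSet Good ∧ Good ⊆ Set.Icc (1 - α) 1 ∧
      ENNReal.ofReal (9 / 10 * α) ≤ MeasureTheory.volume Good ∧
      ∀ a₁ ∈ Good, ∀ a : ℕ → ℝ, a 0 = 1 →
        (∀ t : ℕ, 1 ≤ t → a t = a₁ * (1 - α) ^ (t - 1)) →
        ∀ h q : ℕ → ℝ → ℝ,
          (∀ t : ℕ, ∀ x ∈ Set.Icc (0 : ℝ) 1, h t x ∈ Set.Icc (0 : ℝ) 1) →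
          (∀ t : ℕ, ∀ x ∈ Set.Icc (a (t + 1)) (a t), h t x = 1) →
          (∀ t : ℕ, ∀ x : ℝ, x ∉ Set.Icc ((1 - γ) * a (t + 1)) ((1 + γ) * a t) →
            h t x = 0) →
          (∀ t : ℕ, q t 0 = 0) →
          (∀ t : ℕ, ∀ x y : ℝ, 0 ≤ y → y ≤ x → q t y ≤ c₁ * q t x) →
          (∀ t : ℕ, ∀ x ∈ Set.Icc ((1 - γ) * a (t + 1)) ((1 + γ) * a t),
            |q t x - f x| ≤ ε * f x) →
          (1 - ε - 320 * c₁ * γ / α) * (∑ i, f (μ i))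
              ≤ (∑' t : ℕ, ∑ i, q t (μ i * h t (μ i))) ∧
          (∑' t : ℕ, ∑ i, q t (μ i * h t (μ i)))
              ≤ (1 + ε + 320 * c₁ * γ / α) * (∑ i, f (μ i)) := by
  have hf' : ∀ i, 0 ≤ f (μ i) := fun i => hf _ (hμ i).1
  have hτ : 0 < 80 * γ / α := by have := hα.1; positivity
  set E : Set ℝ := {s | 80 * γ / α * ∑ i, f (μ i)
    < ∑ i, (badShifts α γ (μ i)).indicator (fun _ => f (μ i)) s} with hE
  have hEmeas : MeasurableSet E := measurableSet_lt measurable_const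
    (Finset.measurable_fun_sum _ fun i _ =>
      measurable_const.indicator (measurableSet_badShifts α γ (μ i)))
  have hEvol : MeasureTheory.volume E ≤ ENNReal.ofReal (α / 10) := by
    refine (measure_mul_sum_lt_sum_indicator_le _ _
      (fun i => measurableSet_badShifts α γ (μ i)) _ hf' hτ
      fun i => volume_badShifts_le hα hγ hγ2).trans_eq ?_
    have := hα.1
    congr 1
    field_simp
    norm_num
  refine ⟨Set.Icc (1 - α) 1 \ E, measurableSet_Icc.diff hEmeas, Set.sdiff_subset, ?_, ?_⟩
  · refine le_trans ?_ MeasureTheory.le_measure_sdiff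
    rw [Real.volume_Icc]
    refine le_trans ?_ (tsub_le_tsub_left hEvol _)
    rw [← ENNReal.ofReal_sub _ (by linarith [hα.1])]
    exact ENNReal.ofReal_le_ofReal (by linarith)
  rintro a₁ ⟨ha₁, haE⟩ a ha0 ha h q hh hh1 hh0 hq0 hq hqf
  rw [hE, Set.mem_ofPred_eq, not_lt] at haE
  have key i := windowed_tsum_bounds hα hγ hγ2 hε hc (hμ i) (hf' i) ha₁ ha0 ha
    (η := fun t => h t (μ i)) (fun t => hh t _ ⟨(hμ i).1.le, (hμ i).2⟩) (fun t => hh1 t _)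
    (fun t => hh0 t _) hq0 hq (fun t => hqf t _)
  rw [Summable.tsum_finsetSum fun i _ => (key i).1]
  have hS : 0 ≤ ∑ i, f (μ i) := Finset.sum_nonneg fun i _ => hf' i
  have hc0 : 0 < c₁ := by linarith
  have hcoef : 4 * c₁ * (80 * γ / α * ∑ i, f (μ i)) = 320 * c₁ * γ / α * ∑ i, f (μ i) := by ring
  constructor
  · have h1 := Finset.sum_le_sum fun i (_ : i ∈ Finset.univ) => (key i).2.1
    rw [← Finset.mul_sum] at h1
    have : 0 ≤ 4 * c₁ * (80 * γ / α * ∑ i, f (μ i)) := by positivity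
    linarith
  · have h1 := Finset.sum_le_sum fun i (_ : i ∈ Finset.univ) => (key i).2.2
    rw [Finset.sum_add_distrib, ← Finset.mul_sum, ← Finset.mul_sum] at h1
    have := mul_le_mul_of_nonneg_left haE (show 0 ≤ 4 * c₁ by linarith)
    linarith
end
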